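/- arXiv:1903.01606 — 7 statements merged into one kernel-verified Lean document; each statement's English description precedes it below -/
import Mathlib

section
/- Let n, ℓ, r ≥ 2 and let H be an n-vertex K_{ℓ+1}^{(r)}-free r-graph on vertex set [n]. Then the number of edges of H is at most t_r(n,ℓ). -/
open Finset
open scoped Classical

/-- `turanCount n ℓ r` is `t_r(n,ℓ)`: the number of `r`-element subsets of `[n]`
that meet each class of the balanced partition of `[n]` into `ℓ` parts
(given by residues modulo `ℓ`) in at most one vertex. -/
def turanCount (n ℓ r : ℕ) : ℕ :=
  ((Finset.univ : Finset (Finset (Fin n))).filter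
    (fun A => A.card = r ∧ ∀ x ∈ A, ∀ y ∈ A, x ≠ y → x.val % ℓ ≠ y.val % ℓ)).card

/-- `H` is `K_{ℓ+1}^{(r)}`-free: no `(ℓ+1)`-set `S` such that every pair of distinct
vertices of `S` is covered by an edge of `H`. -/
def KKFree (n ℓ : ℕ) (H : Finset (Finset (Fin n))) : Prop :=
  ¬ ∃ S : Finset (Fin n), S.card = ℓ + 1 ∧
      ∀ x ∈ S, ∀ y ∈ S, x ≠ y → ∃ e ∈ H, x ∈ e ∧ y ∈ e

/-- The multiset of sizes of the residue classes modulo `ℓ` in `{0, …, n - 1}`. -/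
def residueClassSizes (n ℓ : ℕ) : Multiset ℕ :=
  (Finset.range ℓ).val.map fun i => #{x : Fin n | x.val % ℓ = i}

theorem Multiset.esymm_cons_succ {R : Type*} [CommSemiring R] (a : R) (s : Multiset R) (r : ℕ) :
    (a ::ₘ s).esymm (r + 1) = s.esymm (r + 1) + a * s.esymm r := by
  simp [Multiset.esymm, Multiset.powersetCard_cons, Multiset.sum_map_mul_left]

/-- Moving one unit from a larger part to a smaller one does not decrease `esymm`. -/
theorem Multiset.esymm_smoothing (b d : ℕ) (s : Multiset ℕ) (r : ℕ) :
    ((b + d + 2) ::ₘ b ::ₘ s).esymm r ≤ ((b + d + 1) ::ₘ (b + 1) ::ₘ s).esymm r := by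
  match r with
  | 0 => simp [Multiset.esymm]
  | 1 =>
    simp only [Multiset.esymm_cons_succ]
    simp [Multiset.esymm]
    omega
  | r + 2 =>
    simp only [Multiset.esymm_cons_succ]
    nlinarith [Nat.zero_le (d * s.esymm r), Nat.zero_le (s.esymm r)]

theorem Multiset.eq_replicate_add_replicate_of_balanced (s : Multiset ℕ)
    (h : ∀ a ∈ s, ∀ b ∈ s, a ≤ b + 1) :
    s = Multiset.replicate (s.card - s.sum % s.card) (s.sum / s.card) +
      Multiset.replicate (s.sum % s.card) (s.sum / s.card + 1) := by
  rcases s.empty_or_exists_mem with rfl | ⟨c, hc⟩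
  · simp
  obtain ⟨m, hm, hmin⟩ : ∃ m ∈ s, ∀ a ∈ s, m ≤ a := by
    obtain ⟨m, hm, hmin⟩ := s.toFinset.exists_min_image id ⟨c, by simpa using hc⟩
    exact ⟨m, by simpa using hm, fun a ha => hmin a (by simpa using ha)⟩
  have hsplit := Multiset.filter_add_not (· = m) s
  have h1 : s.filter (· = m) = Multiset.replicate (s.filter (· = m)).card m :=
    Multiset.eq_replicate_card.2 fun b hb => (Multiset.mem_filter.1 hb).2
  have h2 : s.filter (¬ · = m) = Multiset.replicate (s.filter (¬ · = m)).card (m + 1) := by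
    refine Multiset.eq_replicate_card.2 fun b hb => ?_
    obtain ⟨hb, hne⟩ := Multiset.mem_filter.1 hb
    have := h b hb m hm
    have := hmin b hb
    omega
  have hpos : 0 < (s.filter (· = m)).card :=
    Multiset.card_pos_iff_exists_mem.2 ⟨m, Multiset.mem_filter.2 ⟨hm, rfl⟩⟩
  generalize (s.filter (· = m)).card = i at *
  generalize (s.filter (¬ · = m)).card = j at *
  rw [h1, h2] at hsplit
  have hcard : s.card = i + j := by rw [← hsplit]; simp
  have hsum : s.sum = j + (i + j) * m := by rw [← hsplit]; simp; ring
  have hmod : s.sum % s.card = j := by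
    rw [hcard, hsum, Nat.add_mul_mod_self_left, Nat.mod_eq_of_lt (by omega)]
  have hdiv : s.sum / s.card = m := by
    rw [hcard, hsum, Nat.add_mul_div_left _ _ (by omega), Nat.div_eq_of_lt (by omega), zero_add]
  rw [hmod, hdiv, hcard, Nat.add_sub_cancel, hsplit]

theorem Multiset.eq_of_balanced {s t : Multiset ℕ}
    (hs : ∀ a ∈ s, ∀ b ∈ s, a ≤ b + 1) (ht : ∀ a ∈ t, ∀ b ∈ t, a ≤ b + 1)
    (hcard : s.card = t.card) (hsum : s.sum = t.sum) : s = t := by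
  rw [s.eq_replicate_add_replicate_of_balanced hs, t.eq_replicate_add_replicate_of_balanced ht,
    hcard, hsum]

/-- Among multisets of naturals with given cardinality and sum, a balanced one maximises every
elementary symmetric polynomial. -/
theorem Multiset.esymm_le_of_balanced {t : Multiset ℕ} (ht : ∀ a ∈ t, ∀ b ∈ t, a ≤ b + 1)
    (s : Multiset ℕ) (hcard : s.card = t.card) (hsum : s.sum = t.sum) (r : ℕ) :
    s.esymm r ≤ t.esymm r := by
  induction hk : (s.map (· ^ 2)).sum using Nat.strong_induction_on generalizing s with
  | _ k ih =>
    by_cases hs : ∀ a ∈ s, ∀ b ∈ s, a ≤ b + 1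
    · rw [Multiset.eq_of_balanced hs ht hcard hsum]
    · push Not at hs
      obtain ⟨a, ha, b, hb, hab⟩ := hs
      obtain ⟨u, rfl⟩ := Multiset.exists_cons_of_mem ha
      have hb : b ∈ u := by
        rcases Multiset.mem_cons.1 hb with rfl | hb
        · omega
        · exact hb
      obtain ⟨u, rfl⟩ := Multiset.exists_cons_of_mem hb
      obtain ⟨d, rfl⟩ : ∃ d, a = b + d + 2 := ⟨a - b - 2, by omega⟩
      refine (Multiset.esymm_smoothing b d u r).trans (ih _ ?_ _ ?_ ?_ rfl)
      · rw [← hk]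
        simp only [Multiset.map_cons, Multiset.sum_cons]
        nlinarith
      · simpa using hcard
      · simp only [Multiset.sum_cons] at hsum ⊢
        omega

theorem card_residueClassSizes (n ℓ : ℕ) : (residueClassSizes n ℓ).card = ℓ := by
  simp [residueClassSizes]

theorem sum_residueClassSizes (n : ℕ) {ℓ : ℕ} (hℓ : 0 < ℓ) : (residueClassSizes n ℓ).sum = n := by
  have := Finset.card_eq_sum_card_fiberwise (s := (univ : Finset (Fin n))) (t := Finset.range ℓ)
    (f := fun x => x.val % ℓ) (fun x _ => by simpa using Nat.mod_lt _ hℓ)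
  rw [Finset.card_univ, Fintype.card_fin] at this
  exact this.symm

theorem card_residueClass (n : ℕ) {ℓ i : ℕ} (hi : i < ℓ) :
    #{x : Fin n | x.val % ℓ = i} = n / ℓ + if i < n % ℓ then 1 else 0 := by
  have h := Nat.count_modEq_card n (by omega : 0 < ℓ) i
  rw [Nat.mod_eq_of_lt hi] at h
  rw [← h, Nat.count_eq_card_filter_range, Finset.card_filter, Finset.card_filter,
    Finset.sum_range]
  simp [Nat.ModEq, Nat.mod_eq_of_lt hi]

theorem residueClassSizes_balanced (n ℓ : ℕ) :
    ∀ a ∈ residueClassSizes n ℓ, ∀ b ∈ residueClassSizes n ℓ, a ≤ b + 1 := by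
  intro a ha b hb
  obtain ⟨i, hi, rfl⟩ := Multiset.mem_map.1 ha
  obtain ⟨j, hj, rfl⟩ := Multiset.mem_map.1 hb
  rw [card_residueClass n (by simpa using hi), card_residueClass n (by simpa using hj)]
  split_ifs <;> omega

theorem esymm_cons_residueClassSizes_le {m n : ℕ} (hmn : m ≤ n) (ℓ r : ℕ) (h : ℓ = 0 → m = 0) :
    ((n - m) ::ₘ residueClassSizes m ℓ).esymm r ≤ (residueClassSizes n (ℓ + 1)).esymm r := by
  refine Multiset.esymm_le_of_balanced (residueClassSizes_balanced n (ℓ + 1)) _ ?_ ?_ r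
  · simp [card_residueClassSizes]
  · rw [sum_residueClassSizes n ℓ.succ_pos, Multiset.sum_cons]
    rcases Nat.eq_zero_or_pos ℓ with rfl | hℓ
    · simp [residueClassSizes, h rfl]
    · rw [sum_residueClassSizes m hℓ]
      omega

namespace SimpleGraph

variable {α : Type*} (G : SimpleGraph α)

/-- The `r`-cliques of `G` with all vertices in `S`. -/
noncomputable def cliquesIn (S : Finset α) (r : ℕ) : Finset (Finset α) :=
  (S.powersetCard r).filter fun A => G.IsClique (A : Set α)

variable {G}

theorem mem_cliquesIn {S A : Finset α} {r : ℕ} :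
    A ∈ G.cliquesIn S r ↔ A ⊆ S ∧ #A = r ∧ G.IsClique (A : Set α) := by
  simp [cliquesIn, and_assoc]

theorem cliquesIn_empty_succ (r : ℕ) : G.cliquesIn ∅ (r + 1) = ∅ := by
  rw [cliquesIn, Finset.powersetCard_eq_empty.2 (by simp), Finset.filter_empty]

theorem card_cliquesIn_zero_le (S : Finset α) : #(G.cliquesIn S 0) ≤ 1 := by
  simpa [cliquesIn] using Finset.card_filter_le {∅} fun A : Finset α => G.IsClique (A : Set α)

theorem card_cliquesIn_mem_le {S : Finset α} (v : α) (r : ℕ) :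
    #{A ∈ G.cliquesIn S (r + 1) | v ∈ A} ≤ #(G.cliquesIn (S.filter (G.Adj v)) r) := by
  refine Finset.card_le_card_of_injOn (·.erase v) ?_ ?_
  · intro A hA
    obtain ⟨hA, hv⟩ := Finset.mem_filter.1 hA
    obtain ⟨hS, hc, hcl⟩ := mem_cliquesIn.1 hA
    refine mem_cliquesIn.2 ⟨?_, by rw [Finset.card_erase_of_mem hv, hc]; rfl, ?_⟩
    · intro x hx
      obtain ⟨hne, hx⟩ := Finset.mem_erase.1 hx
      exact Finset.mem_filter.2 ⟨hS hx, hcl hv hx hne.symm⟩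
    · exact hcl.subset (by simp)
  · intro A hA B hB hAB
    have hA := (Finset.mem_filter.1 hA).2
    have hB := (Finset.mem_filter.1 hB).2
    rw [← Finset.insert_erase hA, ← Finset.insert_erase hB]
    exact congrArg _ hAB

/-- If `v` lies in the most `(r + 1)`-cliques, the clique count is at most the one obtained by
joining the neighbourhood of `v` to an independent set. -/
theorem card_cliquesIn_le_of_max {S : Finset α} {v : α} {r : ℕ}
    (hv : ∀ u ∈ S, #{A ∈ G.cliquesIn S (r + 1) | u ∈ A} ≤ #{A ∈ G.cliquesIn S (r + 1) | v ∈ A}) :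
    #(G.cliquesIn S (r + 1)) ≤ #(G.cliquesIn (S.filter (G.Adj v)) (r + 1)) +
      (#S - #(S.filter (G.Adj v))) * #(G.cliquesIn (S.filter (G.Adj v)) r) := by
  set N := S.filter (G.Adj v) with hN
  have hcover : G.cliquesIn S (r + 1) ⊆ G.cliquesIn N (r + 1) ∪
      (S \ N).biUnion fun u => {A ∈ G.cliquesIn S (r + 1) | u ∈ A} := by
    intro A hA
    obtain ⟨hS, hc, hcl⟩ := mem_cliquesIn.1 hA
    by_cases hAN : A ⊆ N
    · exact Finset.mem_union_left _ (mem_cliquesIn.2 ⟨hAN, hc, hcl⟩)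
    · obtain ⟨u, hu, huN⟩ := Finset.not_subset.1 hAN
      exact Finset.mem_union_right _ (Finset.mem_biUnion.2
        ⟨u, Finset.mem_sdiff.2 ⟨hS hu, huN⟩, Finset.mem_filter.2 ⟨hA, hu⟩⟩)
  refine (Finset.card_le_card hcover).trans ((Finset.card_union_le _ _).trans ?_)
  rw [← Finset.card_sdiff_of_subset (Finset.filter_subset _ S)]
  gcongr
  exact Finset.card_biUnion_le_card_mul _ _ _ fun u hu =>
    (hv u (Finset.mem_sdiff.1 hu).1).trans (card_cliquesIn_mem_le v r)

/-- **Zykov's theorem**: if `S` spans no `(ℓ + 1)`-clique, then it spans at most as many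
`r`-cliques as the balanced complete `ℓ`-partite graph on `#S` vertices. -/
theorem card_cliquesIn_le (ℓ r : ℕ) (S : Finset α) (hS : G.cliquesIn S (ℓ + 1) = ∅) :
    #(G.cliquesIn S r) ≤ (residueClassSizes #S ℓ).esymm r := by
  have hempty (T : Finset α) (hT : G.cliquesIn T 1 = ∅) : T = ∅ := by
    by_contra hne
    obtain ⟨v, hv⟩ := Finset.nonempty_iff_ne_empty.2 hne
    have : {v} ∈ G.cliquesIn T 1 := mem_cliquesIn.2 (by simp [hv])
    simp [hT] at this
  induction ℓ generalizing r S with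
  | zero =>
    obtain rfl := hempty S hS
    cases r with
    | zero => simpa [Multiset.esymm] using card_cliquesIn_zero_le (G := G) ∅
    | succ r => simp [cliquesIn_empty_succ]
  | succ ℓ ih =>
    cases r with
    | zero => simpa [Multiset.esymm] using card_cliquesIn_zero_le S
    | succ r =>
      rcases S.eq_empty_or_nonempty with rfl | hne
      · simp [cliquesIn_empty_succ]
      obtain ⟨v, hvS, hv⟩ :=
        S.exists_max_image (fun u => #{A ∈ G.cliquesIn S (r + 1) | u ∈ A}) hne
      have hN : G.cliquesIn (S.filter (G.Adj v)) (ℓ + 1) = ∅ := by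
        refine Finset.eq_empty_of_forall_notMem fun A hA => ?_
        obtain ⟨hAN, hc, hcl⟩ := mem_cliquesIn.1 hA
        have hadj : ∀ x ∈ A, G.Adj v x := fun x hx => (Finset.mem_filter.1 (hAN hx)).2
        have hvA : v ∉ A := fun h => (hadj v h).ne rfl
        have : insert v A ∈ G.cliquesIn S (ℓ + 1 + 1) := by
          refine mem_cliquesIn.2 ⟨Finset.insert_subset hvS fun x hx =>
            (Finset.mem_filter.1 (hAN hx)).1, by rw [Finset.card_insert_of_notMem hvA, hc], ?_⟩
          rw [Finset.coe_insert]
          exact hcl.insert fun x hx _ => hadj x hx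
        simp [hS] at this
      calc #(G.cliquesIn S (r + 1))
          ≤ _ := card_cliquesIn_le_of_max hv
        _ ≤ _ := Nat.add_le_add (ih (r + 1) _ hN) (Nat.mul_le_mul_left _ (ih r _ hN))
        _ = _ := (Multiset.esymm_cons_succ _ _ _).symm
        _ ≤ _ := esymm_cons_residueClassSizes_le (Finset.card_filter_le _ _) ℓ (r + 1) (by
            rintro rfl
            rw [hempty _ hN, Finset.card_empty])

end SimpleGraph

theorem esymm_residueClassSizes_le_turanCount (n ℓ r : ℕ) :
    (residueClassSizes n ℓ).esymm r ≤ turanCount n ℓ r := by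
  rw [residueClassSizes, Finset.esymm_map_val]
  set c : ℕ → Finset (Fin n) := fun i => {x : Fin n | x.val % ℓ = i} with hc
  have hmem {T : Finset ℕ} {f : (i : ℕ) → i ∈ T → Fin n} (hf : f ∈ T.pi c) (i : ℕ) (hi : i ∈ T) :
      (f i hi).val % ℓ = i := by
    simpa [hc] using Finset.mem_pi.1 hf i hi
  simp_rw [← Finset.card_pi]
  rw [← Finset.card_sigma]
  refine Finset.card_le_card_of_injOn
    (fun p => p.1.attach.image fun i => p.2 i.1 i.2) ?_ ?_
  · rintro ⟨T, f⟩ hp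
    obtain ⟨hT, hf⟩ := Finset.mem_sigma.1 hp
    refine Finset.mem_filter.2 ⟨Finset.mem_univ _, ?_, ?_⟩
    · rw [Finset.card_image_of_injective, Finset.card_attach, (Finset.mem_powersetCard.1 hT).2]
      intro i j hij
      have := congrArg (fun x : Fin n => x.val % ℓ) hij
      simp only [hmem hf] at this
      exact Subtype.ext this
    · simp only [Finset.mem_image, Finset.mem_attach, true_and]
      rintro _ ⟨i, rfl⟩ _ ⟨j, rfl⟩ hne
      rw [hmem hf, hmem hf]
      intro hij
      obtain rfl := Subtype.ext hij
      exact hne rfl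
  · rintro ⟨T, f⟩ hp ⟨U, g⟩ hq heq
    have hf : f ∈ T.pi c := (Finset.mem_sigma.1 hp).2
    have hg : g ∈ U.pi c := (Finset.mem_sigma.1 hq).2
    replace heq : (T.attach.image fun i => f i.1 i.2) = U.attach.image fun i => g i.1 i.2 := heq
    have himage {W : Finset ℕ} {h : (i : ℕ) → i ∈ W → Fin n} (hh : h ∈ W.pi c) :
        (W.attach.image fun i => h i.1 i.2).image (fun x => x.val % ℓ) = W := by
      ext i
      simp only [Finset.mem_image, Finset.mem_attach, true_and]
      constructor
      · rintro ⟨_, ⟨j, rfl⟩, rfl⟩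
        rw [hmem hh]
        exact j.2
      · exact fun hi => ⟨_, ⟨⟨i, hi⟩, rfl⟩, hmem hh i hi⟩
    obtain rfl : T = U := by
      rw [← himage hf, heq, himage hg]
    congr 1
    funext i hi
    have : f i hi ∈ T.attach.image fun i => g i.1 i.2 := by
      rw [← heq]
      exact Finset.mem_image_of_mem _ (Finset.mem_attach T ⟨i, hi⟩)
    obtain ⟨j, -, hj⟩ := Finset.mem_image.1 this
    have hji : j.1 = i := by rw [← hmem hg j.1 j.2, hj, hmem hf]
    subst hji
    exact hj.symm

theorem stmt_0 (n ℓ r : ℕ) (hn : 2 ≤ n) (hℓ : 2 ≤ ℓ) (hr : 2 ≤ r)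
    (H : Finset (Finset (Fin n))) (hH : ∀ e ∈ H, e.card = r)
    (hfree : KKFree n ℓ H) :
    H.card ≤ turanCount n ℓ r := by
  let G : SimpleGraph (Fin n) := SimpleGraph.fromRel fun x y => ∃ e ∈ H, x ∈ e ∧ y ∈ e
  have hadj {x y : Fin n} : G.Adj x y ↔ x ≠ y ∧ ∃ e ∈ H, x ∈ e ∧ y ∈ e := by
    rw [SimpleGraph.fromRel_adj]
    refine and_congr_right fun _ => ⟨?_, Or.inl⟩
    rintro (h | ⟨e, he, hy, hx⟩)
    exacts [h, ⟨e, he, hx, hy⟩]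
  have hsub : H ⊆ G.cliquesIn univ r := fun e he =>
    SimpleGraph.mem_cliquesIn.2 ⟨Finset.subset_univ e, hH e he,
      fun x hx y hy hne => hadj.2 ⟨hne, e, he, hx, hy⟩⟩
  have hG : G.cliquesIn univ (ℓ + 1) = ∅ := by
    refine Finset.eq_empty_of_forall_notMem fun A hA => hfree ⟨A, ?_⟩
    obtain ⟨-, hc, hcl⟩ := SimpleGraph.mem_cliquesIn.1 hA
    exact ⟨hc, fun x hx y hy hne => (hadj.1 (hcl hx hy hne)).2⟩
  calc #H ≤ #(G.cliquesIn univ r) := Finset.card_le_card hsub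
    _ ≤ (residueClassSizes #(univ : Finset (Fin n)) ℓ).esymm r :=
      SimpleGraph.card_cliquesIn_le ℓ r univ hG
    _ ≤ turanCount n ℓ r := by
      rw [Finset.card_univ, Fintype.card_fin]
      exact esymm_residueClassSizes_le_turanCount n ℓ r
end

section
/- Fix ℓ ≥ r ≥ 2 and δ > 0, and set ε = (r−2)!·δ. There exists n₀ such that for all n ≥ n₀ the following holds: if H is an n-vertex K_{ℓ+1}^{(r)}-free r-graph on [n] with at least (1−ε)·t_r(n,ℓ) edges, then [n] has a partition V₁ ∪ … ∪ V_ℓ such that the number of edges of H containing at least two vertices in some single part V_i is at most δ·n^r. -/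
open Finset
open scoped Classical

namespace SimpleGraph

variable {V : Type*} [Fintype V] [DecidableEq V] (G : SimpleGraph V)

/-- The vertices adjacent to every vertex of `L`. -/
noncomputable def commonNbrs (L : Finset V) : Finset V := {w | ∀ v ∈ L, G.Adj v w}

theorem mem_commonNbrs {L : Finset V} {w : V} :
    w ∈ G.commonNbrs L ↔ ∀ v ∈ L, G.Adj v w := by
  simp [commonNbrs]

theorem sum_cliqueFinset_succ_sum_erase (s : ℕ) (F : Finset V → ℕ) :
    ∑ K ∈ G.cliqueFinset (s + 1), ∑ v ∈ K, F (K.erase v) =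
      ∑ L ∈ G.cliqueFinset s, #(G.commonNbrs L) * F L := by
  simp_rw [← smul_eq_mul, ← Finset.sum_const]
  rw [Finset.sum_sigma', Finset.sum_sigma']
  refine Finset.sum_bij' (fun p _ => ⟨p.1.erase p.2, p.2⟩) (fun p _ => ⟨insert p.2 p.1, p.2⟩)
    ?_ ?_ ?_ ?_ ?_
  · rintro ⟨K, v⟩ h
    simp only [mem_sigma, mem_cliqueFinset_iff, mem_commonNbrs] at h ⊢
    refine ⟨h.1.erase_of_mem h.2, fun u hu => ?_⟩
    exact h.1.isClique (mem_of_mem_erase hu) h.2 (ne_of_mem_erase hu)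
  · rintro ⟨L, w⟩ h
    simp only [mem_sigma, mem_cliqueFinset_iff, mem_commonNbrs] at h ⊢
    exact ⟨h.1.insert fun v hv => (h.2 v hv).symm, mem_insert_self _ _⟩
  · rintro ⟨K, v⟩ h
    simp only [mem_sigma] at h
    simp [insert_erase h.2]
  · rintro ⟨L, w⟩ h
    simp only [mem_sigma, mem_commonNbrs] at h
    have : w ∉ L := fun hw => G.irrefl (h.2 w hw)
    simp [erase_insert this]
  · rintro ⟨K, v⟩ _
    rfl

theorem sum_card_commonNbrs (s : ℕ) :
    ∑ L ∈ G.cliqueFinset s, #(G.commonNbrs L) = (s + 1) * #(G.cliqueFinset (s + 1)) := by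
  have h := G.sum_cliqueFinset_succ_sum_erase s fun _ => 1
  simp only [mul_one, sum_const, smul_eq_mul] at h
  rw [← h, Finset.sum_const_nat fun K hK => ((mem_cliqueFinset_iff).1 hK).card_eq, mul_comm]

theorem sum_card_commonNbrs_erase_le (s : ℕ) (K : Finset V) (hK : #K = s + 1) :
    ∑ v ∈ K, #(G.commonNbrs (K.erase v)) ≤ Fintype.card V + s * #(G.commonNbrs K) := by
  have h (w : V) : #{v ∈ K | w ∈ G.commonNbrs (K.erase v)} ≤
      1 + s * if w ∈ G.commonNbrs K then 1 else 0 := by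
    split_ifs with hw
    · calc _ ≤ #K := card_filter_le _ _
        _ = 1 + s * 1 := by omega
    · rw [mem_commonNbrs] at hw
      push Not at hw
      obtain ⟨u, hu, huw⟩ := hw
      rw [mul_zero, add_zero, ← card_singleton u]
      refine card_le_card fun v hv => ?_
      rw [mem_filter, mem_commonNbrs] at hv
      by_contra hvu
      rw [mem_singleton] at hvu
      exact huw (hv.2 u (mem_erase.2 ⟨fun h => hvu h.symm, hu⟩))
  calc ∑ v ∈ K, #(G.commonNbrs (K.erase v))
      = ∑ v ∈ K, ∑ w : V, if w ∈ G.commonNbrs (K.erase v) then 1 else 0 := by simp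
    _ = ∑ w : V, #{v ∈ K | w ∈ G.commonNbrs (K.erase v)} := by
        rw [sum_comm]; simp
    _ ≤ ∑ w : V, (1 + s * if w ∈ G.commonNbrs K then 1 else 0) := sum_le_sum fun w _ => h w
    _ = Fintype.card V + s * #(G.commonNbrs K) := by
        rw [sum_add_distrib, ← mul_sum]; simp

/-- The **Moon–Moser inequality** between the numbers of cliques of consecutive sizes. -/
theorem moon_moser (s : ℕ) :
    ((s + 1) * #(G.cliqueFinset (s + 1))) ^ 2 ≤ #(G.cliqueFinset s) *
      (Fintype.card V * #(G.cliqueFinset (s + 1)) +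
        s * ((s + 2) * #(G.cliqueFinset (s + 2)))) := by
  rw [← sum_card_commonNbrs]
  refine sq_sum_le_card_mul_sum_sq.trans (Nat.mul_le_mul_left _ ?_)
  calc ∑ L ∈ G.cliqueFinset s, #(G.commonNbrs L) ^ 2
      = ∑ K ∈ G.cliqueFinset (s + 1), ∑ v ∈ K, #(G.commonNbrs (K.erase v)) := by
        rw [sum_cliqueFinset_succ_sum_erase G s fun L => #(G.commonNbrs L)]
        simp_rw [sq]
    _ ≤ ∑ K ∈ G.cliqueFinset (s + 1), (Fintype.card V + s * #(G.commonNbrs K)) :=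
        sum_le_sum fun K hK =>
          G.sum_card_commonNbrs_erase_le s K (mem_cliqueFinset_iff.1 hK).card_eq
    _ = _ := by
        rw [sum_add_distrib, ← mul_sum, sum_card_commonNbrs G (s + 1)]
        simp [mul_comm]

variable {G}

theorem CliqueFree.card_cliqueFinset_succ_le {ℓ : ℕ} (hG : G.CliqueFree (ℓ + 1)) :
    ∀ j s : ℕ, s + j = ℓ → ℓ * ((s + 1) * #(G.cliqueFinset (s + 1))) ≤
      j * (Fintype.card V * #(G.cliqueFinset s))
  | 0, s, h => by
    obtain rfl : s = ℓ := h
    rw [(cliqueFinset_eq_empty_iff).2 hG]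
    simp
  | j + 1, s, h => by
    have ih := hG.card_cliqueFinset_succ_le j (s + 1) (by omega)
    have mm := G.moon_moser s
    rw [show s + 1 + 1 = s + 2 from rfl] at ih
    generalize #(G.cliqueFinset s) = a at *
    generalize #(G.cliqueFinset (s + 1)) = b at *
    generalize #(G.cliqueFinset (s + 2)) = c at *
    generalize Fintype.card V = n at *
    rcases Nat.eq_zero_or_pos b with rfl | hb
    · simp
    refine Nat.le_of_mul_le_mul_left ?_ (Nat.mul_pos (Nat.succ_pos s) hb)
    calc (s + 1) * b * (ℓ * ((s + 1) * b)) = ℓ * ((s + 1) * b) ^ 2 := by ring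
      _ ≤ ℓ * (a * (n * b + s * ((s + 2) * c))) := Nat.mul_le_mul_left _ mm
      _ = a * (n * b * ℓ + s * (ℓ * ((s + 2) * c))) := by ring
      _ ≤ a * (n * b * ℓ + s * (j * (n * b))) := by gcongr
      _ = (s + 1) * b * ((j + 1) * (n * a)) := by rw [← h]; ring

theorem CliqueFree.card_cliqueFinset_le {ℓ : ℕ} (hG : G.CliqueFree (ℓ + 1)) (k : ℕ)
    (hk : k + 2 ≤ ℓ) :
    ℓ ^ k * #(G.cliqueFinset (k + 2)) * ℓ.choose 2 ≤
      #(G.cliqueFinset 2) * Fintype.card V ^ k * ℓ.choose (k + 2) := by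
  induction k with
  | zero => simp
  | succ k ih =>
    have ih := ih (by omega)
    have h := hG.card_cliqueFinset_succ_le (ℓ - (k + 2)) (k + 2) (by omega)
    have hc := Nat.choose_succ_right_eq ℓ (k + 2)
    rw [show k + 1 + 2 = k + 2 + 1 from rfl]
    generalize #(G.cliqueFinset (k + 2 + 1)) = b at *
    generalize #(G.cliqueFinset (k + 2)) = a at *
    generalize Fintype.card V = n at *
    generalize ℓ - (k + 2) = j at *
    refine Nat.le_of_mul_le_mul_left ?_ (Nat.succ_pos (k + 2))
    calc (k + 2 + 1) * (ℓ ^ (k + 1) * b * ℓ.choose 2)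
        = ℓ ^ k * ℓ.choose 2 * (ℓ * ((k + 2 + 1) * b)) := by ring
      _ ≤ ℓ ^ k * ℓ.choose 2 * (j * (n * a)) := Nat.mul_le_mul_left _ h
      _ = j * n * (ℓ ^ k * a * ℓ.choose 2) := by ring
      _ ≤ j * n * (#(G.cliqueFinset 2) * n ^ k * ℓ.choose (k + 2)) := Nat.mul_le_mul_left _ ih
      _ = #(G.cliqueFinset 2) * n ^ (k + 1) * (ℓ.choose (k + 2) * j) := by ring
      _ = (k + 2 + 1) * (#(G.cliqueFinset 2) * n ^ (k + 1) * ℓ.choose (k + 2 + 1)) := by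
        rw [← hc]; ring

theorem sum_adj_eq_two_mul_card_cliqueFinset :
    ∑ u : V, ∑ v : V, (if G.Adj u v then 1 else 0) = 2 * #(G.cliqueFinset 2) := by
  rw [← G.sum_card_commonNbrs 1]
  refine Finset.sum_bij (fun u _ => {u}) ?_ ?_ ?_ ?_
  · simp [mem_cliqueFinset_iff, isNClique_iff]
  · simp
  · intro L hL
    obtain ⟨u, rfl⟩ := card_eq_one.1 (mem_cliqueFinset_iff.1 hL).card_eq
    exact ⟨u, mem_univ u, rfl⟩
  · intro u _
    simp [commonNbrs]

end SimpleGraph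

/-- **Füredi's stability lemma**: inside a vertex set `W` without `(ℓ + 1)`-cliques there is a
partition into `ℓ` parts such that the number of ordered adjacent pairs, where pairs inside a part
are counted twice, is at most `(1 - 1 / ℓ) * |W| ^ 2`. -/
theorem SimpleGraph.exists_coloring_sum_adj_le {V : Type*} [DecidableEq V]
    (G : SimpleGraph V) (ℓ : ℕ) :
    ∀ W : Finset V, (∀ S ⊆ W, ¬ G.IsNClique (ℓ + 1) S) →
    ∃ c : V → ℕ, (∀ v ∈ W, c v < ℓ) ∧
      ℓ * ∑ u ∈ W, ∑ v ∈ W, (if G.Adj u v then (if c u = c v then 2 else 1) else 0) + #W ^ 2 ≤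
        ℓ * #W ^ 2 := by
  induction ℓ with
  | zero =>
    intro W hW
    have : W = ∅ := by
      refine eq_empty_of_forall_notMem fun x hx => hW {x} (by simpa using hx) ?_
      simp [SimpleGraph.isNClique_iff]
    subst this
    exact ⟨fun _ => 0, by simp⟩
  | succ ℓ ih =>
    intro W hW
    rcases W.eq_empty_or_nonempty with rfl | hne
    · exact ⟨fun _ => 0, by simp⟩
    obtain ⟨x, hxW, hx⟩ := exists_max_image W (fun u => #{v ∈ W | G.Adj u v}) hne
    set B := {v ∈ W | G.Adj x v} with hB
    set A := {v ∈ W | ¬ G.Adj x v} with hA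
    have hBfree : ∀ S ⊆ B, ¬ G.IsNClique (ℓ + 1) S := by
      intro S hS hcl
      refine hW (insert x S) ?_ (hcl.insert fun v hv => (mem_filter.1 (hS hv)).2)
      exact insert_subset hxW (hS.trans (filter_subset _ _))
    obtain ⟨c, hc, hsum⟩ := ih B hBfree
    have hcard : #B + #A = #W := card_filter_add_card_filter_not _
    refine ⟨fun v => if v ∈ B then c v else ℓ, fun v _ => ?_, ?_⟩
    · dsimp only
      split_ifs with h
      · have := hc v h; omega
      · omega
    set g : V → V → ℕ := fun u v => if G.Adj u v then
      (if (if u ∈ B then c u else ℓ) = (if v ∈ B then c v else ℓ) then 2 else 1) else 0 with hg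
    have hAB : ∀ v ∈ A, v ∉ B := fun v hv hv' => (mem_filter.1 hv).2 (mem_filter.1 hv').2
    have split (F : V → ℕ) : ∑ v ∈ W, F v = ∑ v ∈ B, F v + ∑ v ∈ A, F v :=
      (sum_filter_add_sum_filter_not W _ F).symm
    set a : V → V → ℕ := fun u v => if G.Adj u v then 1 else 0 with ha
    have hBB : ∑ u ∈ B, ∑ v ∈ B, g u v =
        ∑ u ∈ B, ∑ v ∈ B, (if G.Adj u v then (if c u = c v then 2 else 1) else 0) := by
      refine sum_congr rfl fun u hu => sum_congr rfl fun v hv => ?_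
      simp [hg, hu, hv]
    have hgAB : ∑ u ∈ A, ∑ v ∈ B, g u v = ∑ u ∈ A, ∑ v ∈ B, a u v := by
      refine sum_congr rfl fun u hu => sum_congr rfl fun v hv => ?_
      have := (hc v hv).ne'
      simp [hg, ha, hAB u hu, hv, this]
    have hgBA : ∑ u ∈ B, ∑ v ∈ A, g u v = ∑ u ∈ A, ∑ v ∈ B, a u v := by
      rw [sum_comm]
      refine sum_congr rfl fun u hu => sum_congr rfl fun v hv => ?_
      have := (hc v hv).ne
      simp [hg, ha, hAB u hu, hv, this, G.adj_comm u v]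
    have hgAA : ∑ u ∈ A, ∑ v ∈ A, g u v = 2 * ∑ u ∈ A, ∑ v ∈ A, a u v := by
      simp_rw [mul_sum]
      refine sum_congr rfl fun u hu => sum_congr rfl fun v hv => ?_
      simp [hg, ha, hAB u hu, hAB v hv]
    have hdeg : ∑ u ∈ A, ∑ v ∈ B, a u v + ∑ u ∈ A, ∑ v ∈ A, a u v ≤ #A * #B := by
      rw [← sum_add_distrib, ← smul_eq_mul]
      refine sum_le_card_nsmul _ _ _ fun u hu => ?_
      rw [← split, ha]
      simpa using hx u (mem_filter.1 hu).1
    have htotal : ∑ u ∈ W, ∑ v ∈ W, g u v ≤ 2 * (#A * #B) +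
        ∑ u ∈ B, ∑ v ∈ B, (if G.Adj u v then (if c u = c v then 2 else 1) else 0) := by
      simp_rw [split, sum_add_distrib]
      omega
    rw [← hcard]
    rcases Nat.eq_zero_or_pos ℓ with rfl | hℓ
    · have hB0 : B = ∅ := eq_empty_of_forall_notMem fun y hy => absurd (hc y hy) (by omega)
      rw [hB0] at htotal
      simp only [card_empty, mul_zero, sum_empty, add_zero, Nat.le_zero] at htotal
      change (0 + 1) * ∑ u ∈ W, ∑ v ∈ W, g u v + _ ≤ _
      simp only [htotal]
      simp
    · generalize ∑ u ∈ W, ∑ v ∈ W, g u v = S at *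
      generalize ∑ u ∈ B, ∑ v ∈ B,
        (if G.Adj u v then (if c u = c v then 2 else 1) else 0) = T at *
      generalize #A = p at *
      generalize #B = q at *
      refine Nat.le_of_mul_le_mul_left ?_ hℓ
      zify at *
      nlinarith [sq_nonneg ((ℓ : ℤ) * p - q),
        mul_le_mul_of_nonneg_left htotal (by positivity : (0 : ℤ) ≤ ℓ * (ℓ + 1)),
        mul_le_mul_of_nonneg_left hsum (by positivity : (0 : ℤ) ≤ (ℓ + 1))]

theorem choose_mul_div_pow_le_turanCount (n ℓ r : ℕ) :
    ℓ.choose r * (n / ℓ) ^ r ≤ turanCount n ℓ r := by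
  rcases Nat.eq_zero_or_pos ℓ with rfl | hℓ
  · rcases Nat.eq_zero_or_pos r with rfl | hr
    · simp only [Nat.choose_self, pow_zero, mul_one, turanCount]
      exact card_pos.2 ⟨∅, by simp⟩
    · simp [hr.ne']
  set q := n / ℓ with hq
  have hlt (i : Fin ℓ) (j : Fin q) : ℓ * j.val + i.val < n := by
    have h1 : ℓ * (j.val + 1) ≤ ℓ * q := Nat.mul_le_mul_left _ j.2
    have h2 : ℓ * q ≤ n := Nat.mul_div_le n ℓ
    have := i.2
    rw [mul_add] at h1
    omega
  let e (i : Fin ℓ) (j : Fin q) : Fin n := ⟨ℓ * j.val + i.val, hlt i j⟩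
  have hmod (i : Fin ℓ) (j : Fin q) : (e i j).val % ℓ = i.val := by
    simp [e, Nat.mod_eq_of_lt i.2]
  have hfst {i i' : Fin ℓ} {j j' : Fin q} (h : e i j = e i' j') : i = i' := by
    ext; rw [← hmod i j, h, hmod]
  have hsnd {i : Fin ℓ} {j j' : Fin q} (h : e i j = e i j') : j = j' := by
    have h' : ℓ * j.val + i.val = ℓ * j'.val + i.val := congrArg Fin.val h
    ext
    exact Nat.eq_of_mul_eq_mul_left hℓ (by omega)
  let F (p : Σ T : Finset (Fin ℓ), T → Fin q) : Finset (Fin n) :=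
    univ.image fun i : p.1 => e i.1 (p.2 i)
  have hmem (T : Finset (Fin ℓ)) (g : T → Fin q) (i : Fin ℓ) (j : Fin q) :
      e i j ∈ F ⟨T, g⟩ ↔ ∃ h : i ∈ T, g ⟨i, h⟩ = j := by
    simp only [F, mem_image, mem_univ, true_and, Subtype.exists]
    constructor
    · rintro ⟨i', hi', h⟩
      obtain rfl := hfst h
      exact ⟨hi', hsnd h⟩
    · rintro ⟨h, rfl⟩
      exact ⟨i, h, rfl⟩
  have hinj : Function.Injective F := by
    rintro ⟨T, g⟩ ⟨T', g'⟩ h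
    have key (i : Fin ℓ) (j : Fin q) :
        (∃ h : i ∈ T, g ⟨i, h⟩ = j) ↔ ∃ h : i ∈ T', g' ⟨i, h⟩ = j := by
      rw [← hmem, ← hmem, h]
    obtain rfl : T = T' := by
      ext i
      exact ⟨fun hi => ((key i _).1 ⟨hi, rfl⟩).1, fun hi => ((key i _).2 ⟨hi, rfl⟩).1⟩
    congr 1
    ext1 i
    exact ((key i.1 _).1 ⟨i.2, rfl⟩).2.symm
  calc ℓ.choose r * q ^ r
      = #((powersetCard r (univ : Finset (Fin ℓ))).sigma
          fun T => (univ : Finset (T → Fin q))) := by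
        rw [card_sigma, sum_const_nat (m := q ^ r)]
        · simp
        · intro T hT
          simp [(mem_powersetCard.1 hT).2]
    _ ≤ turanCount n ℓ r := by
        refine card_le_card_of_injOn F ?_ hinj.injOn
        rintro ⟨T, g⟩ hp
        have hT : #T = r := by simpa [mem_powersetCard] using hp
        simp only [coe_filter, mem_univ, true_and, Set.mem_ofPred_eq]
        constructor
        · rw [card_image_of_injective _ fun i i' h => Subtype.ext (hfst h)]
          simpa using hT
        · simp only [F, mem_image, mem_univ, true_and]
          rintro _ ⟨i, rfl⟩ _ ⟨i', rfl⟩ hne heq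
          rw [hmod, hmod] at heq
          obtain rfl : i = i' := Subtype.ext (Fin.ext heq)
          exact hne rfl

theorem card_filter_two_le_card_fiber_le {V ι : Type*} [Fintype V] [DecidableEq V]
    [Fintype ι] [DecidableEq ι]
    (H : Finset (Finset V)) (k : ℕ) (hH : ∀ e ∈ H, #e = k + 2) (f : V → ι) (G : SimpleGraph V)
    (hG : ∀ x y, G.Adj x y ↔ x ≠ y ∧ ∃ e ∈ H, x ∈ e ∧ y ∈ e) :
    #{e ∈ H | ∃ i, 2 ≤ #{v ∈ e | f v = i}} ≤
      (∑ u, ∑ v, if G.Adj u v ∧ f u = f v then 1 else 0) * (Fintype.card V).choose k := by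
  have hP : ∑ u, ∑ v, (if G.Adj u v ∧ f u = f v then 1 else 0) =
      #{p : V × V | G.Adj p.1 p.2 ∧ f p.1 = f p.2} := by
    rw [← sum_product']; simp
  rw [hP]
  calc _ ≤ #(({p : V × V | G.Adj p.1 p.2 ∧ f p.1 = f p.2} : Finset (V × V)).biUnion
        fun p => {e ∈ H | p.1 ∈ e ∧ p.2 ∈ e}) := by
        refine card_le_card fun e he => ?_
        obtain ⟨heH, i, hi⟩ := mem_filter.1 he
        obtain ⟨u, hu, v, hv, huv⟩ := one_lt_card.1 hi
        rw [mem_filter] at hu hv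
        rw [mem_biUnion]
        refine ⟨(u, v), ?_, mem_filter.2 ⟨heH, hu.1, hv.1⟩⟩
        rw [mem_filter]
        exact ⟨mem_univ _, (hG u v).2 ⟨huv, e, heH, hu.1, hv.1⟩, hu.2.trans hv.2.symm⟩
    _ ≤ _ := by
        refine card_biUnion_le_card_mul _ _ _ fun p hp => ?_
        have hne : p.1 ≠ p.2 := (mem_filter.1 hp).2.1.ne
        rw [← card_univ, ← card_powersetCard]
        have hsub {e : Finset V} (he : e ∈ ({e ∈ H | p.1 ∈ e ∧ p.2 ∈ e} : Finset _)) :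
            {p.1, p.2} ⊆ e := by
          have := (mem_filter.1 he).2
          intro x hx
          rw [mem_insert, mem_singleton] at hx
          rcases hx with rfl | rfl
          exacts [this.1, this.2]
        refine card_le_card_of_injOn (fun e => e \ {p.1, p.2}) ?_ ?_
        · intro e he
          rw [mem_coe, mem_powersetCard, card_sdiff_of_subset (hsub he), card_pair hne,
            hH e (mem_filter.1 he).1]
          exact ⟨subset_univ _, rfl⟩
        · intro e he e' he' h
          rw [← sdiff_union_of_subset (hsub he), ← sdiff_union_of_subset (hsub he')]
          exact congrArg (· ∪ {p.1, p.2}) h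

theorem one_sub_mul_div_pow_le_natDiv_pow {n ℓ r : ℕ} (hℓ : 0 < ℓ) {η : ℝ}
    (hn : r * ℓ ≤ η * n) (hnℓ : ℓ ≤ n) :
    (1 - η) * ((n : ℝ) / ℓ) ^ r ≤ ((n / ℓ : ℕ) : ℝ) ^ r := by
  have hℓ' : (0 : ℝ) < ℓ := by exact_mod_cast hℓ
  have hnℓ' : (ℓ : ℝ) ≤ n := by exact_mod_cast hnℓ
  have hn0 : (0 : ℝ) < n := hℓ'.trans_le hnℓ'
  have hle : (ℓ : ℝ) / n ≤ 1 := (div_le_one hn0).2 hnℓ'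
  have hq : (n : ℝ) / ℓ * (1 + -(ℓ / n)) ≤ ((n / ℓ : ℕ) : ℝ) := by
    have h : (n : ℝ) / ℓ < (n / ℓ : ℕ) + 1 := by
      rw [div_lt_iff₀ hℓ']
      rw [mul_comm]
      exact_mod_cast Nat.lt_mul_div_succ n hℓ
    have : (n : ℝ) / ℓ * (1 + -(ℓ / n)) = n / ℓ - 1 := by field_simp; ring
    linarith
  have hB := one_add_mul_le_pow (a := -((ℓ : ℝ) / n)) (by linarith) r
  have hη : 1 - η ≤ 1 + r * -((ℓ : ℝ) / n) := by
    have : r * ((ℓ : ℝ) / n) ≤ η := by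
      rw [← mul_div_assoc, div_le_iff₀ hn0]; exact hn
    linarith
  calc (1 - η) * ((n : ℝ) / ℓ) ^ r ≤ (1 + -((ℓ : ℝ) / n)) ^ r * ((n : ℝ) / ℓ) ^ r := by
        gcongr; exact hη.trans hB
    _ = ((n : ℝ) / ℓ * (1 + -(ℓ / n))) ^ r := by rw [mul_pow, mul_comm]
    _ ≤ _ := by
        refine pow_le_pow_left₀ (mul_nonneg (by positivity) (by linarith)) hq r

/-- If the number `K` of `r`-cliques of a `K_{ℓ+1}`-free graph is almost that of the Turán graph,
then so is the number `E` of its edges; hence the number `M` of ordered pairs in Füredi's lemma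
is small. Here `r = k + 2`. -/
theorem le_mul_sq_of_counts {n ℓ k E K M t : ℕ} (hkℓ : k + 2 ≤ ℓ) (hn : 0 < n) {ε η : ℝ}
    (hε : 0 < ε) (hη : η = ε / (ℓ - 1))
    (hclique : ℓ ^ k * K * ℓ.choose 2 ≤ E * n ^ k * ℓ.choose (k + 2))
    (hfuredi : ℓ * (2 * E + M) + n ^ 2 ≤ ℓ * n ^ 2)
    (ht : (1 - η) * ((n : ℝ) / ℓ) ^ (k + 2) * ℓ.choose (k + 2) ≤ t)
    (hK : (1 - ε) * t ≤ K) :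
    (M : ℝ) ≤ ε * n ^ 2 := by
  have hℓ : (2 : ℝ) ≤ ℓ := by exact_mod_cast (by omega : 2 ≤ ℓ)
  have hn' : (0 : ℝ) < n := by exact_mod_cast hn
  have hC : (0 : ℝ) < ℓ.choose (k + 2) := by exact_mod_cast Nat.choose_pos hkℓ
  have hf : (ℓ : ℝ) * (2 * E + M) + n ^ 2 ≤ ℓ * n ^ 2 := by exact_mod_cast hfuredi
  rcases le_or_gt 1 ε with h1 | h1
  · have hE : (0 : ℝ) ≤ E := Nat.cast_nonneg _
    have : (M : ℝ) ≤ n ^ 2 := by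
      refine le_of_mul_le_mul_left ?_ (by linarith : (0 : ℝ) < ℓ)
      nlinarith [sq_nonneg (n : ℝ), mul_nonneg (by linarith : (0 : ℝ) ≤ ℓ) hE]
    nlinarith [sq_nonneg (n : ℝ)]
  have hc : (ℓ : ℝ) ^ k * K * (ℓ * (ℓ - 1) / 2) ≤ E * n ^ k * ℓ.choose (k + 2) := by
    rw [← Nat.cast_choose_two]; exact_mod_cast hclique
  have hlow : (1 - ε) * ((1 - η) * ((n : ℝ) / ℓ) ^ (k + 2) * ℓ.choose (k + 2)) ≤ K :=
    (mul_le_mul_of_nonneg_left ht (by linarith)).trans hK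
  have hEdge : (1 - ε) * (1 - η) * (ℓ - 1) * n ^ 2 ≤ 2 * ℓ * E := by
    have hpos : (0 : ℝ) < n ^ k * ℓ.choose (k + 2) := by positivity
    refine le_of_mul_le_mul_right ?_ hpos
    have h := mul_le_mul_of_nonneg_left hlow
      (by have : (0 : ℝ) ≤ ℓ - 1 := by linarith
          positivity : (0 : ℝ) ≤ (ℓ : ℝ) ^ k * ℓ ^ 2 * (ℓ - 1))
    have hpow : ((n : ℝ) / ℓ) ^ (k + 2) * (ℓ ^ k * ℓ ^ 2) = n ^ k * n ^ 2 := by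
      rw [← pow_add, ← pow_add, ← mul_pow, div_mul_cancel₀ _ (by linarith)]
    calc (1 - ε) * (1 - η) * (ℓ - 1) * n ^ 2 * (n ^ k * ℓ.choose (k + 2))
        = (1 - ε) * (1 - η) * (ℓ - 1) * ℓ.choose (k + 2) * (n ^ k * n ^ 2) := by ring
      _ = ℓ ^ k * ℓ ^ 2 * (ℓ - 1) *
          ((1 - ε) * ((1 - η) * ((n : ℝ) / ℓ) ^ (k + 2) * ℓ.choose (k + 2))) := by
        rw [← hpow]; ring
      _ ≤ ℓ ^ k * ℓ ^ 2 * (ℓ - 1) * K := h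
      _ = 2 * ℓ * (ℓ ^ k * K * (ℓ * (ℓ - 1) / 2)) := by ring
      _ ≤ 2 * ℓ * (E * n ^ k * ℓ.choose (k + 2)) := by gcongr
      _ = _ := by ring
  have hη' : η * (ℓ - 1) = ε := by rw [hη, div_mul_cancel₀ _ (by linarith)]
  have hη0 : 0 ≤ η := by rw [hη]; exact div_nonneg hε.le (by linarith)
  refine le_of_mul_le_mul_left ?_ (by linarith : (0 : ℝ) < ℓ)
  calc (ℓ : ℝ) * M ≤ (ℓ - 1) * n ^ 2 - (1 - ε) * (1 - η) * (ℓ - 1) * n ^ 2 := by linarith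
    _ = (ε * (ℓ - 1) + (1 - ε) * (η * (ℓ - 1))) * n ^ 2 := by ring
    _ = (ε * ℓ - ε * ε) * n ^ 2 := by rw [hη']; ring
    _ ≤ ℓ * (ε * n ^ 2) := by nlinarith [mul_nonneg (sq_nonneg ε) (sq_nonneg (n : ℝ))]

theorem stmt_2 (ℓ r : ℕ) (hr : 2 ≤ r) (hrℓ : r ≤ ℓ) (δ : ℝ) (hδ : 0 < δ) :
    ∃ n₀ : ℕ, ∀ n : ℕ, n₀ ≤ n → ∀ H : Finset (Finset (Fin n)),
      (∀ e ∈ H, e.card = r) → KKFree n ℓ H →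
      (1 - ((r - 2).factorial : ℝ) * δ) * (turanCount n ℓ r : ℝ) ≤ (H.card : ℝ) →
      ∃ f : Fin n → Fin ℓ,
        ((H.filter fun e => ∃ i : Fin ℓ, 2 ≤ (e.filter fun v => f v = i).card).card : ℝ)
          ≤ δ * (n : ℝ) ^ r := by
  obtain ⟨k, rfl⟩ : ∃ k, r = k + 2 := ⟨r - 2, by omega⟩
  rw [Nat.add_sub_cancel]
  set ε : ℝ := (k.factorial : ℝ) * δ with hε_def
  have hε : 0 < ε := by positivity
  have hℓ : (2 : ℝ) ≤ ℓ := by exact_mod_cast (by omega : 2 ≤ ℓ)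
  set η : ℝ := ε / (ℓ - 1) with hη_def
  have hη : 0 < η := div_pos hε (by linarith)
  refine ⟨max ℓ ⌈((k + 2 : ℕ) * ℓ : ℝ) / η⌉₊, fun n hn H hH hfree hcard => ?_⟩
  have hnℓ : ℓ ≤ n := (le_max_left _ _).trans hn
  have hnη : ((k + 2 : ℕ) * ℓ : ℝ) ≤ η * n := by
    rw [mul_comm η, ← div_le_iff₀ hη]
    exact Nat.ceil_le.1 ((le_max_right _ _).trans hn)
  obtain ⟨G, hG⟩ : ∃ G : SimpleGraph (Fin n),
      ∀ x y, G.Adj x y ↔ x ≠ y ∧ ∃ e ∈ H, x ∈ e ∧ y ∈ e :=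
    ⟨{ Adj := fun x y => x ≠ y ∧ ∃ e ∈ H, x ∈ e ∧ y ∈ e
       symm := ⟨fun x y h => ⟨h.1.symm, h.2.imp fun e he => ⟨he.1, he.2.2, he.2.1⟩⟩⟩
       loopless := ⟨fun x h => h.1 rfl⟩ }, fun _ _ => Iff.rfl⟩
  have hGfree : G.CliqueFree (ℓ + 1) := fun S hS =>
    hfree ⟨S, hS.card_eq, fun x hx y hy hxy => ((hG x y).1 (hS.isClique hx hy hxy)).2⟩
  have hHsub : H ⊆ G.cliqueFinset (k + 2) := fun e he => by
    rw [SimpleGraph.mem_cliqueFinset_iff, SimpleGraph.isNClique_iff]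
    exact ⟨fun x hx y hy hxy => (hG x y).2 ⟨hxy, e, he, hx, hy⟩, hH e he⟩
  obtain ⟨c, hc, hsum⟩ := G.exists_coloring_sum_adj_le ℓ univ fun S _ => hGfree S
  let f : Fin n → Fin ℓ := fun v => ⟨c v, hc v (mem_univ v)⟩
  refine ⟨f, ?_⟩
  have hbad := card_filter_two_le_card_fiber_le H k hH f G hG
  set M := ∑ u, ∑ v, (if G.Adj u v ∧ f u = f v then 1 else 0) with hM_def
  have hsplit : ∑ u, ∑ v, (if G.Adj u v then (if c u = c v then 2 else 1) else 0) =
      2 * #(G.cliqueFinset 2) + M := by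
    rw [← SimpleGraph.sum_adj_eq_two_mul_card_cliqueFinset, hM_def]
    simp_rw [← sum_add_distrib]
    refine sum_congr rfl fun u _ => sum_congr rfl fun v _ => ?_
    by_cases h1 : G.Adj u v <;> by_cases h2 : c u = c v <;> simp [h1, h2, f]
  rw [hsplit, card_univ, Fintype.card_fin] at hsum
  have hclique := hGfree.card_cliqueFinset_le k hrℓ
  rw [Fintype.card_fin] at hclique hbad
  have hn0 : 0 < n := by omega
  have hM : (M : ℝ) ≤ ε * n ^ 2 := by
    refine le_mul_sq_of_counts hrℓ hn0 hε hη_def hclique hsum ?_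
      (hcard.trans (by exact_mod_cast card_le_card hHsub))
    calc _ ≤ ((n / ℓ : ℕ) : ℝ) ^ (k + 2) * ℓ.choose (k + 2) := by
          gcongr
          exact one_sub_mul_div_pow_le_natDiv_pow (by omega) hnη hnℓ
      _ ≤ turanCount n ℓ (k + 2) := by
          rw [mul_comm]
          exact_mod_cast choose_mul_div_pow_le_turanCount n ℓ (k + 2)
  calc _ ≤ ((M * n.choose k : ℕ) : ℝ) := by
        rw [Nat.cast_le]
        convert hbad
    _ = (M : ℝ) * n.choose k := Nat.cast_mul _ _
    _ ≤ ε * n ^ 2 * (n ^ k / k.factorial) := by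
        gcongr
        exact Nat.choose_le_pow_div k n
    _ = δ * n ^ (k + 2) := by rw [hε_def]; field_simp; ring
end

section
/- Every cancellative 3-graph on n vertices has at most t_3(n,3) edges, where t_3(n,3) = ⌊n/3⌋·⌊(n+1)/3⌋·⌊(n+2)/3⌋. -/
open Finset
open scoped Classical

/-- `H` is cancellative: it contains no three distinct edges `A`, `B`, `C`
with `A △ B ⊆ C`. -/
def Cancellative (n : ℕ) (H : Finset (Finset (Fin n))) : Prop :=
  ∀ A ∈ H, ∀ B ∈ H, ∀ C ∈ H, A ≠ B → A ≠ C → B ≠ C → ¬ (symmDiff A B ⊆ C)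

/-- `t3 n = t_3(n,3) = ⌊n/3⌋·⌊(n+1)/3⌋·⌊(n+2)/3⌋`. -/
def t3 (n : ℕ) : ℕ := (n / 3) * ((n + 1) / 3) * ((n + 2) / 3)

variable {V : Type*} [DecidableEq V]

/-- The number of edges of the blow-up of `G` in which the vertex `v` is replaced by `w v` copies. -/
def blowupCard (G : Finset (Finset V)) (w : V → ℕ) : ℕ := ∑ e ∈ G, ∏ v ∈ e, w v

/-- Move the whole weight of `v` to `u`. -/
def shiftWeight (w : V → ℕ) (u v : V) : V → ℕ :=
  Function.update (Function.update w u (w u + w v)) v 0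

lemma le_t3_of_le_add {N q d : ℕ} (hN : 3 ≤ N) (hd : 3 * d + 3 * N ≤ N ^ 2 + 3)
    (hq : q ≤ t3 (N - 3) + d) : q ≤ t3 N := by
  obtain ⟨k, i, hi, rfl⟩ : ∃ k i, i < 3 ∧ N = 3 * (k + 1) + i :=
    ⟨N / 3 - 1, N % 3, Nat.mod_lt _ (by norm_num), by omega⟩
  have e0 : 3 * (k + 1) + i - 3 = 3 * k + i := by omega
  rw [e0] at hq
  unfold t3 at *
  interval_cases i
  · have h1 : (3 * k + 0) / 3 = k := by omega
    have h2 : (3 * k + 0 + 1) / 3 = k := by omega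
    have h3 : (3 * k + 0 + 2) / 3 = k := by omega
    have h4 : (3 * (k + 1) + 0) / 3 = k + 1 := by omega
    have h5 : (3 * (k + 1) + 0 + 1) / 3 = k + 1 := by omega
    have h6 : (3 * (k + 1) + 0 + 2) / 3 = k + 1 := by omega
    rw [h1, h2, h3] at hq
    rw [h4, h5, h6]
    nlinarith
  · have h1 : (3 * k + 1) / 3 = k := by omega
    have h2 : (3 * k + 1 + 1) / 3 = k := by omega
    have h3 : (3 * k + 1 + 2) / 3 = k + 1 := by omega
    have h4 : (3 * (k + 1) + 1) / 3 = k + 1 := by omega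
    have h5 : (3 * (k + 1) + 1 + 1) / 3 = k + 1 := by omega
    have h6 : (3 * (k + 1) + 1 + 2) / 3 = k + 2 := by omega
    rw [h1, h2, h3] at hq
    rw [h4, h5, h6]
    have : d ≤ 3 * k ^ 2 + 5 * k + 2 := by
      by_contra! h
      nlinarith
    nlinarith
  · have h1 : (3 * k + 2) / 3 = k := by omega
    have h2 : (3 * k + 2 + 1) / 3 = k + 1 := by omega
    have h3 : (3 * k + 2 + 2) / 3 = k + 1 := by omega
    have h4 : (3 * (k + 1) + 2) / 3 = k + 1 := by omega
    have h5 : (3 * (k + 1) + 2 + 1) / 3 = k + 2 := by omega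
    have h6 : (3 * (k + 1) + 2 + 2) / 3 = k + 2 := by omega
    rw [h1, h2, h3] at hq
    rw [h4, h5, h6]
    have : d ≤ 3 * k ^ 2 + 7 * k + 4 := by
      by_contra! h
      nlinarith
    nlinarith

/-- The arithmetic behind the induction step: `a, b, c` are the weights on an edge, `r` and `S` the
sum and the sum of squares of the remaining weights, and `Q` the weight of the pairs outside the
edge that are completed to an edge by one of its vertices. -/
lemma link_bound {a b c r S Q : ℕ} (ha : 1 ≤ a) (hb : 1 ≤ b) (hc : 1 ≤ c) (hrS : r ≤ S)
    (hSa : S ≤ a * r) (h₁ : 2 * Q + S ≤ r ^ 2) (h₂ : 2 * Q ≤ 3 * S) :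
    3 * (a * b + b * c + c * a + Q) + 3 * r ≤ (a + b + c + r) ^ 2 := by
  zify at *
  have hs : 3 * (a * b + b * c + c * a : ℤ) ≤ (a + b + c) ^ 2 := by
    nlinarith [sq_nonneg (a - b : ℤ), sq_nonneg (b - c : ℤ), sq_nonneg (c - a : ℤ)]
  have hr : (0 : ℤ) ≤ r := by positivity
  by_cases h : (r + 3 : ℤ) ≤ 4 * (a + b + c)
  · nlinarith [mul_nonneg hr (sub_nonneg.2 h)]
  · have h3 : (0 : ℤ) ≤ 2 * r + 12 - 5 * (a + b + c) := by linarith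
    have h4 : (a : ℤ) * r ≤ (a + b + c - 2) * r := by
      apply mul_le_mul_of_nonneg_right _ hr
      linarith
    nlinarith [mul_nonneg hr h3]

lemma blowupCard_eq_of_eq_off_pair {G : Finset (Finset V)} {u v : V}
    (huv : ∀ e ∈ G, ¬ (u ∈ e ∧ v ∈ e)) {w w' : V → ℕ} (hw : ∀ x, x ≠ u → x ≠ v → w' x = w x) :
    blowupCard G w' =
      w' u * (∑ e ∈ G, if u ∈ e then ∏ x ∈ e.erase u, w x else 0) +
      w' v * (∑ e ∈ G, if v ∈ e then ∏ x ∈ e.erase v, w x else 0) +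
      ∑ e ∈ G, if u ∉ e ∧ v ∉ e then ∏ x ∈ e, w x else 0 := by
  rw [blowupCard, mul_sum, mul_sum, ← sum_add_distrib, ← sum_add_distrib]
  refine sum_congr rfl fun e he => ?_
  have hne := huv e he
  by_cases hu : u ∈ e
  · have hv : v ∉ e := fun hv => hne ⟨hu, hv⟩
    simp only [hu, hv, if_true, if_false, not_true, false_and, mul_zero, add_zero]
    rw [← mul_prod_erase e w' hu]
    congr 1
    refine prod_congr rfl fun x hx => hw x (ne_of_mem_erase hx) ?_
    rintro rfl
    exact hv (mem_of_mem_erase hx)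
  · by_cases hv : v ∈ e
    · simp only [hu, hv, if_true, if_false, not_true, and_false, mul_zero, add_zero, zero_add]
      rw [← mul_prod_erase e w' hv]
      congr 1
      refine prod_congr rfl fun x hx => hw x ?_ (ne_of_mem_erase hx)
      rintro rfl
      exact hu (mem_of_mem_erase hx)
    · simp only [hu, hv, if_false, not_false_eq_true, and_self, if_true, mul_zero, zero_add]
      refine prod_congr rfl fun x hx => hw x ?_ ?_
      · rintro rfl
        exact hu hx
      · rintro rfl
        exact hv hx

lemma blowupCard_le_shiftWeight {G : Finset (Finset V)} {u v : V} (hne : u ≠ v)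
    (huv : ∀ e ∈ G, ¬ (u ∈ e ∧ v ∈ e)) (w : V → ℕ) :
    blowupCard G w ≤ blowupCard G (shiftWeight w u v) ∨
      blowupCard G w ≤ blowupCard G (shiftWeight w v u) := by
  rw [blowupCard_eq_of_eq_off_pair huv (w := w) (w' := w) (fun _ _ _ => rfl),
    blowupCard_eq_of_eq_off_pair huv (w := w) (w' := shiftWeight w u v)
      (fun x hu hv => by simp [shiftWeight, hu, hv]),
    blowupCard_eq_of_eq_off_pair huv (w := w) (w' := shiftWeight w v u)
      (fun x hu hv => by simp [shiftWeight, hu, hv])]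
  generalize (∑ e ∈ G, if u ∈ e then ∏ x ∈ e.erase u, w x else 0) = A
  generalize (∑ e ∈ G, if v ∈ e then ∏ x ∈ e.erase v, w x else 0) = B
  simp only [shiftWeight, Function.update_self, Function.update_of_ne hne,
    Function.update_of_ne hne.symm]
  rcases le_total A B with h | h
  · right
    nlinarith [Nat.mul_le_mul_left (w u) h]
  · left
    nlinarith [Nat.mul_le_mul_left (w v) h]

lemma sum_shiftWeight [Fintype V] {u v : V} (hne : u ≠ v) (w : V → ℕ) :
    ∑ x, shiftWeight w u v x = ∑ x, w x := by
  have hv : v ∈ univ.erase u := by simp [hne.symm]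
  rw [← add_sum_erase univ _ (mem_univ u), ← add_sum_erase univ w (mem_univ u),
    ← add_sum_erase _ _ hv, ← add_sum_erase _ w hv]
  have : ∑ x ∈ (univ.erase u).erase v, shiftWeight w u v x = ∑ x ∈ (univ.erase u).erase v, w x := by
    refine sum_congr rfl fun x hx => ?_
    simp only [mem_erase] at hx
    simp [shiftWeight, hx.1, hx.2.1]
  rw [this]
  simp [shiftWeight, hne, add_assoc]

lemma card_support_shiftWeight_lt [Fintype V] {u v : V} {w : V → ℕ} (hu : 0 < w u)
    (hv : 0 < w v) : #{x | 0 < shiftWeight w u v x} < #{x | 0 < w x} := by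
  refine card_lt_card (Finset.ssubset_iff_subset_ne.2 ⟨fun x hx => ?_, fun h => ?_⟩)
  · simp only [mem_filter, mem_univ, true_and] at hx ⊢
    by_cases h1 : x = v
    · rwa [h1]
    · by_cases h2 : x = u
      · rwa [h2]
      · simpa [shiftWeight, h1, h2] using hx
  · have : v ∈ ({x | 0 < w x} : Finset V) := by simpa using hv
    rw [← h, mem_filter] at this
    simp [shiftWeight] at this

lemma eq_of_two_common {n : ℕ} {G : Finset (Finset (Fin n))} (hG : ∀ e ∈ G, #e = 3)
    (hc : Cancellative n G) {w : Fin n → ℕ} (hpos : ∀ e ∈ G, ∀ v ∈ e, 0 < w v)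
    (hcov : ∀ u v, u ≠ v → 0 < w u → 0 < w v → ∃ e ∈ G, u ∈ e ∧ v ∈ e)
    {A B : Finset (Fin n)} (hA : A ∈ G) (hB : B ∈ G) {u v : Fin n} (huv : u ≠ v)
    (huA : u ∈ A) (huB : u ∈ B) (hvA : v ∈ A) (hvB : v ∈ B) : A = B := by
  by_contra hAB
  have h2 : 2 ≤ #(A ∩ B) := by
    rw [← card_pair huv]
    refine card_le_card fun x hx => ?_
    simp only [mem_insert, mem_singleton] at hx
    rcases hx with rfl | rfl <;> simp [*]
  have hlt : #(A ∩ B) < 3 := by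
    by_contra! h
    have e1 := eq_of_subset_of_card_le (inter_subset_left : A ∩ B ⊆ A) (by rw [hG A hA]; exact h)
    have e2 := eq_of_subset_of_card_le (inter_subset_right : A ∩ B ⊆ B) (by rw [hG B hB]; exact h)
    exact hAB (e1.symm.trans e2)
  have c1 := card_sdiff_add_card_inter A B
  have c2 := card_sdiff_add_card_inter B A
  rw [inter_comm] at c2
  rw [hG A hA] at c1
  rw [hG B hB] at c2
  obtain ⟨p, hp⟩ := card_eq_one.1 (show #(A \ B) = 1 by omega)
  obtain ⟨q, hq⟩ := card_eq_one.1 (show #(B \ A) = 1 by omega)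
  have hp' : p ∈ A \ B := by simp [hp]
  have hq' : q ∈ B \ A := by simp [hq]
  rw [mem_sdiff] at hp' hq'
  have hpq : p ≠ q := by
    rintro rfl
    exact hp'.2 hq'.1
  obtain ⟨C, hC, hpC, hqC⟩ := hcov p q hpq (hpos A hA p hp'.1) (hpos B hB q hq'.1)
  refine hc A hA B hB C hC hAB ?_ ?_ fun x hx => ?_
  · rintro rfl
    exact hq'.2 hqC
  · rintro rfl
    exact hp'.2 hpC
  · rcases mem_symmDiff.1 hx with h | h
    · have : x ∈ A \ B := mem_sdiff.2 h
      rw [hp, mem_singleton] at this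
      rwa [this]
    · have : x ∈ B \ A := mem_sdiff.2 h
      rw [hq, mem_singleton] at this
      rwa [this]

/-- The total weight of the pairs outside `E` that are completed to an edge by a vertex of `E`. -/
def outerLink (G : Finset (Finset V)) (E : Finset V) (w : V → ℕ) : ℕ :=
  ∑ e ∈ G with #(e ∩ E) = 1, ∏ v ∈ e \ E, w v

lemma card_sdiff_eq_two {e E : Finset V} (he : #e = 3) (h : #(e ∩ E) = 1) : #(e \ E) = 2 := by
  have := card_sdiff_add_card_inter e E
  omega

lemma two_mul_outerLink_add_le [Fintype V] {G : Finset (Finset V)} (hG : ∀ e ∈ G, #e = 3)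
    (hlin : ∀ A ∈ G, ∀ B ∈ G, ∀ u v, u ≠ v → u ∈ A → u ∈ B → v ∈ A → v ∈ B → A = B)
    (E : Finset V) (w : V → ℕ) :
    2 * outerLink G E w + ∑ v ∈ Eᶜ, w v ^ 2 ≤ (∑ v ∈ Eᶜ, w v) ^ 2 := by
  have h1 : 2 * outerLink G E w =
      ∑ e ∈ G with #(e ∩ E) = 1, ∑ p ∈ (e \ E).offDiag, w p.1 * w p.2 := by
    rw [outerLink, mul_sum]
    refine sum_congr rfl fun e he => ?_
    rw [mem_filter] at he
    obtain ⟨j, k, hjk, h⟩ := card_eq_two.1 (card_sdiff_eq_two (hG e he.1) he.2)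
    have hoff : ({j, k} : Finset V).offDiag = {(j, k), (k, j)} := by
      ext ⟨x, y⟩
      simp only [mem_offDiag, mem_insert, mem_singleton, Prod.mk.injEq]
      grind
    rw [h, hoff, prod_pair hjk, sum_pair (by simp [hjk])]
    ring
  have h2 : 2 * outerLink G E w ≤ ∑ p ∈ Eᶜ.offDiag, w p.1 * w p.2 := by
    rw [h1, ← sum_biUnion]
    · refine sum_le_sum_of_subset fun p hp => ?_
      simp only [mem_biUnion, mem_offDiag, mem_sdiff, mem_compl] at hp ⊢
      obtain ⟨e, -, h1, h2, h3⟩ := hp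
      exact ⟨h1.2, h2.2, h3⟩
    · intro A hA B hB hAB
      refine Finset.disjoint_left.2 fun p hpA hpB => hAB ?_
      simp only [mem_offDiag, mem_sdiff] at hpA hpB
      exact hlin A (mem_filter.1 hA).1 B (mem_filter.1 hB).1 p.1 p.2 hpA.2.2 hpA.1.1 hpB.1.1
        hpA.2.1.1 hpB.2.1.1
  have h3 : (∑ v ∈ Eᶜ, w v) ^ 2 =
      ∑ v ∈ Eᶜ, w v ^ 2 + ∑ p ∈ Eᶜ.offDiag, w p.1 * w p.2 := by
    rw [sq, sum_mul_sum, ← sum_product', ← diag_union_offDiag, sum_union (disjoint_diag_offDiag _),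
      sum_diag]
    simp [sq]
  omega

lemma two_mul_outerLink_le [Fintype V] {G : Finset (Finset V)} (hG : ∀ e ∈ G, #e = 3)
    (hlin : ∀ A ∈ G, ∀ B ∈ G, ∀ u v, u ≠ v → u ∈ A → u ∈ B → v ∈ A → v ∈ B → A = B)
    {E : Finset V} (hE : #E = 3) (w : V → ℕ) :
    2 * outerLink G E w ≤ 3 * ∑ v ∈ Eᶜ, w v ^ 2 := by
  calc 2 * outerLink G E w
      ≤ ∑ e ∈ G with #(e ∩ E) = 1, ∑ v ∈ e \ E, w v ^ 2 := by
        rw [outerLink, mul_sum]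
        refine sum_le_sum fun e he => ?_
        rw [mem_filter] at he
        obtain ⟨j, k, hjk, h⟩ := card_eq_two.1 (card_sdiff_eq_two (hG e he.1) he.2)
        rw [h, prod_pair hjk, sum_pair hjk, ← mul_assoc]
        exact two_mul_le_add_sq _ _
    _ = ∑ v ∈ Eᶜ, ∑ e ∈ G with #(e ∩ E) = 1 ∧ v ∈ e, w v ^ 2 := by
        refine sum_comm' fun e v => ?_
        simp only [mem_filter, mem_sdiff, mem_compl]
        tauto
    _ ≤ ∑ v ∈ Eᶜ, 3 * w v ^ 2 := by
        refine sum_le_sum fun v hv => ?_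
        rw [sum_const, smul_eq_mul]
        refine Nat.mul_le_mul_right _ ?_
        have h3 : #(E.powersetCard 1) = 3 := by simp [hE]
        rw [← h3]
        refine card_le_card_of_injOn (fun e => e ∩ E) (fun e he => ?_) fun A hA B hB hAB => ?_
        · have he' := (mem_filter.1 he).2.1
          exact mem_powersetCard.2 ⟨inter_subset_right, he'⟩
        · have hA' := mem_filter.1 hA
          have hB' := mem_filter.1 hB
          obtain ⟨t, ht⟩ := card_eq_one.1 hA'.2.1
          have htA : t ∈ A ∩ E := by simp [ht]
          have htB : t ∈ B ∩ E := by
            have : A ∩ E = B ∩ E := hAB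
            rwa [← this]
          rw [mem_inter] at htA htB
          refine hlin A hA'.1 B hB'.1 t v ?_ htA.1 htB.1 hA'.2.2 hB'.2.2
          rintro rfl
          exact (mem_compl.1 hv) htA.2
    _ = 3 * ∑ v ∈ Eᶜ, w v ^ 2 := by rw [mul_sum]

lemma blowupCard_sub_edge {G : Finset (Finset V)} {w : V → ℕ}
    (hpos : ∀ e ∈ G, ∀ v ∈ e, 0 < w v)
    (hlin : ∀ A ∈ G, ∀ B ∈ G, ∀ u v, u ≠ v → u ∈ A → u ∈ B → v ∈ A → v ∈ B → A = B)
    {x y z : V} (hxy : x ≠ y) (hxz : x ≠ z) (hyz : y ≠ z) (hE : {x, y, z} ∈ G) :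
    blowupCard G w + (w x + w y + w z) =
      blowupCard G (fun v => if v ∈ ({x, y, z} : Finset V) then w v - 1 else w v) +
        (w x * w y + w y * w z + w z * w x + outerLink G {x, y, z} w + 1) := by
  set E : Finset V := {x, y, z} with hEdef
  set w' : V → ℕ := fun v => if v ∈ E then w v - 1 else w v with hw'
  have hother : ∀ e ∈ G.erase E,
      ∏ v ∈ e, w v = ∏ v ∈ e, w' v + if #(e ∩ E) = 1 then ∏ v ∈ e \ E, w v else 0 := by
    intro e he
    obtain ⟨hne, heG⟩ := mem_erase.1 he
    have hle : #(e ∩ E) ≤ 1 := by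
      refine card_le_one.2 fun s hs t ht => ?_
      by_contra hst
      rw [mem_inter] at hs ht
      exact hne (hlin e heG E hE s t hst hs.1 hs.2 ht.1 ht.2)
    have hsd : ∏ v ∈ e \ E, w' v = ∏ v ∈ e \ E, w v :=
      prod_congr rfl fun v hv => if_neg (mem_sdiff.1 hv).2
    rw [← prod_inter_mul_prod_sdiff e E w, ← prod_inter_mul_prod_sdiff e E w', hsd]
    by_cases h1 : #(e ∩ E) = 1
    · obtain ⟨t, ht⟩ := card_eq_one.1 h1
      have htE : t ∈ e ∩ E := by simp [ht]
      rw [mem_inter] at htE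
      have hwt : w t = w' t + 1 := by
        have := hpos e heG t htE.1
        simp only [hw', htE.2, if_true]
        omega
      rw [if_pos h1, ht, prod_singleton, prod_singleton, hwt]
      ring
    · have h0 : e ∩ E = ∅ := card_eq_zero.1 (by omega)
      simp [h0]
  have hEE : #(E ∩ E) ≠ 1 := by
    rw [inter_self, hEdef, card_eq_three.2 ⟨x, y, z, hxy, hxz, hyz, rfl⟩]
    norm_num
  have hout : outerLink G E w = ∑ e ∈ G.erase E, if #(e ∩ E) = 1 then ∏ v ∈ e \ E, w v else 0 := by
    rw [outerLink, sum_filter, ← add_sum_erase G _ hE, if_neg hEE, zero_add]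
  have hprod : ∀ f : V → ℕ, ∏ v ∈ E, f v = f x * f y * f z := fun f => by
    rw [hEdef, prod_insert (by simp [hxy, hxz]), prod_pair hyz, mul_assoc]
  rw [blowupCard, blowupCard, ← add_sum_erase G _ hE, ← add_sum_erase G (fun e => ∏ v ∈ e, w' v) hE,
    sum_congr rfl hother, sum_add_distrib, ← hout, hprod, hprod]
  have key : ∀ v ∈ E, w v = w' v + 1 := fun v hv => by
    have := hpos E hE v hv
    simp only [hw', hv, if_true]
    omega
  rw [key x (by simp [hEdef]), key y (by simp [hEdef]), key z (by simp [hEdef])]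
  ring

theorem blowupCard_le_t3 {n : ℕ} (G : Finset (Finset (Fin n))) (w : Fin n → ℕ)
    (hG : ∀ e ∈ G, #e = 3) (hc : Cancellative n G) : blowupCard G w ≤ t3 (∑ v, w v) := by
  induction hm : ∑ v, w v + #{v | 0 < w v} using Nat.strong_induction_on generalizing G w with
  | _ m ih =>
  have hred : blowupCard G w = blowupCard {e ∈ G | ∀ v ∈ e, 0 < w v} w := by
    rw [blowupCard, blowupCard, sum_filter]
    refine sum_congr rfl fun e _ => ?_
    split_ifs with h
    · rfl
    · push Not at h
      obtain ⟨v, hv, h0⟩ := h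
      exact prod_eq_zero hv (by omega)
  have hG' : ∀ e ∈ ({e ∈ G | ∀ v ∈ e, 0 < w v} : Finset _), #e = 3 :=
    fun e he => hG e (mem_filter.1 he).1
  have hc' : Cancellative n {e ∈ G | ∀ v ∈ e, 0 < w v} := fun A hA B hB C hC =>
    hc A (mem_filter.1 hA).1 B (mem_filter.1 hB).1 C (mem_filter.1 hC).1
  have hpos : ∀ e ∈ ({e ∈ G | ∀ v ∈ e, 0 < w v} : Finset _), ∀ v ∈ e, 0 < w v :=
    fun e he => (mem_filter.1 he).2
  rw [hred]
  generalize ({e ∈ G | ∀ v ∈ e, 0 < w v} : Finset (Finset (Fin n))) = G' at hG' hc' hpos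
  clear hred hG hc G
  by_cases hcov : ∀ u v, u ≠ v → 0 < w u → 0 < w v → ∃ e ∈ G', u ∈ e ∧ v ∈ e
  swap
  · push Not at hcov
    obtain ⟨u, v, huv, hu, hv, hno⟩ := hcov
    have hno' : ∀ e ∈ G', ¬ (u ∈ e ∧ v ∈ e) := fun e he h => hno e he h.1 h.2
    have step : ∀ a b, a ≠ b → 0 < w a → 0 < w b →
        blowupCard G' (shiftWeight w a b) ≤ t3 (∑ v, w v) := fun a b hab ha hb => by
      have hs := sum_shiftWeight hab w
      have := ih _ (by rw [← hm, hs]; have := card_support_shiftWeight_lt ha hb; omega)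
        G' (shiftWeight w a b) hG' hc' rfl
      rwa [hs] at this
    rcases blowupCard_le_shiftWeight huv hno' w with h | h
    · exact h.trans (step u v huv hu hv)
    · exact h.trans (step v u huv.symm hv hu)
  rcases G'.eq_empty_or_nonempty with rfl | ⟨e₀, he₀⟩
  · simp [blowupCard]
  have hlin : ∀ A ∈ G', ∀ B ∈ G', ∀ u v, u ≠ v → u ∈ A → u ∈ B → v ∈ A → v ∈ B → A = B :=
    fun A hA B hB u v huv h1 h2 h3 h4 =>
      eq_of_two_common hG' hc' hpos hcov hA hB huv h1 h2 h3 h4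
  obtain ⟨p, q, _, -, -, -, rfl⟩ := card_eq_three.1 (hG' e₀ he₀)
  obtain ⟨x, -, hx⟩ := exists_max_image univ w ⟨p, mem_univ p⟩
  have hp0 : 0 < w p := hpos _ he₀ p (by simp)
  have hx0 : 0 < w x := hp0.trans_le (hx p (mem_univ p))
  obtain ⟨E, hE, hxE⟩ : ∃ E ∈ G', x ∈ E := by
    by_cases h : x = p
    · exact ⟨_, he₀, by simp [h]⟩
    · obtain ⟨E, hE, h1, -⟩ := hcov x p h hx0 hp0
      exact ⟨E, hE, h1⟩
  obtain ⟨y, z, hyz, hErase⟩ := card_eq_two.1 (show #(E.erase x) = 2 by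
    rw [card_erase_of_mem hxE, hG' E hE])
  have hEeq : E = {x, y, z} := by rw [← insert_erase hxE, hErase]
  have hxy : x ≠ y := fun h => by
    have : y ∈ E.erase x := by simp [hErase]
    exact ne_of_mem_erase this h.symm
  have hxz : x ≠ z := fun h => by
    have : z ∈ E.erase x := by simp [hErase]
    exact ne_of_mem_erase this h.symm
  subst hEeq
  have hy0 : 0 < w y := hpos _ hE y (by simp)
  have hz0 : 0 < w z := hpos _ hE z (by simp)
  have hsub := blowupCard_sub_edge hpos hlin hxy hxz hyz hE
  have hQ₁ := two_mul_outerLink_add_le hG' hlin {x, y, z} w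
  have hQ₂ := two_mul_outerLink_le hG' hlin (hG' _ hE) w
  have hsumE : ∀ f : Fin n → ℕ, ∑ v ∈ ({x, y, z} : Finset (Fin n)), f v = f x + f y + f z :=
    fun f => by rw [sum_insert (by simp [hxy, hxz]), sum_pair hyz, add_assoc]
  have hsum : ∑ v, w v = w x + w y + w z + ∑ v ∈ ({x, y, z} : Finset (Fin n))ᶜ, w v := by
    rw [← hsumE, sum_add_sum_compl]
  set w' : Fin n → ℕ := fun v => if v ∈ ({x, y, z} : Finset (Fin n)) then w v - 1 else w v with hw'
  have hle : ∀ v, w' v ≤ w v := fun v => by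
    simp only [hw']
    split_ifs <;> omega
  have hsum' : ∑ v, w' v = ∑ v, w v - 3 := by
    have hout : ∑ v ∈ ({x, y, z} : Finset (Fin n))ᶜ, w' v =
        ∑ v ∈ ({x, y, z} : Finset (Fin n))ᶜ, w v :=
      sum_congr rfl fun v hv => if_neg (mem_compl.1 hv)
    rw [← sum_add_sum_compl {x, y, z}, hsumE, hout, hsum]
    simp only [hw', mem_insert, mem_singleton, true_or, or_true, if_true]
    omega
  have hsupp : #{v | 0 < w' v} ≤ #{v | 0 < w v} :=
    card_le_card (monotone_filter_right _ fun v _ h => lt_of_lt_of_le h (hle v))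
  have hind := ih _ (by rw [← hm, hsum']; omega) G' w' hG' hc' rfl
  have hrS : ∑ v ∈ ({x, y, z} : Finset (Fin n))ᶜ, w v ≤
      ∑ v ∈ ({x, y, z} : Finset (Fin n))ᶜ, w v ^ 2 :=
    sum_le_sum fun v _ => Nat.le_self_pow (by norm_num) _
  have hSa : ∑ v ∈ ({x, y, z} : Finset (Fin n))ᶜ, w v ^ 2 ≤
      w x * ∑ v ∈ ({x, y, z} : Finset (Fin n))ᶜ, w v := by
    rw [mul_sum]
    refine sum_le_sum fun v _ => ?_
    rw [sq]
    exact Nat.mul_le_mul_right _ (hx v (mem_univ v))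
  have hlink := link_bound hx0 hy0 hz0 hrS hSa hQ₁ hQ₂
  have hge : w x + w y + w z ≤ w x * w y + w y * w z + w z * w x +
      outerLink G' {x, y, z} w + 1 := by
    nlinarith [Nat.mul_le_mul hx0 hy0, Nat.mul_le_mul hy0 hz0, Nat.mul_le_mul hz0 hx0,
      mul_nonneg (Nat.zero_le (w x - 1)) (Nat.zero_le (w y - 1))]
  rw [hsum'] at hind
  refine le_t3_of_le_add (d := w x * w y + w y * w z + w z * w x +
    outerLink G' {x, y, z} w + 1 - (w x + w y + w z)) (by omega) ?_ (by omega)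
  rw [← hsum] at hlink
  omega

theorem stmt_3 (n : ℕ) (H : Finset (Finset (Fin n)))
    (hH : ∀ e ∈ H, e.card = 3) (hc : Cancellative n H) :
    H.card ≤ t3 n := by
  simpa [blowupCard] using blowupCard_le_t3 H (fun _ => 1) hH hc
end

section
/- If H is a cancellative 3-graph on vertex set [n] with exactly t_3(n,3) edges, where t_3(n,3) > 0, then there is a partition [n] = V₁ ∪ V₂ ∪ V₃ with each part of size ⌊n/3⌋ or ⌈n/3⌉ such that H consists precisely of all 3-element subsets of [n] having exactly one vertex in each V_i. -/
open Finset
open scoped Classical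

lemma Cancellative.not_mem_of_insert_mem {m : ℕ} {H : Finset (Finset (Fin m))}
    (hc : Cancellative m H) {a b : Fin m} {P g : Finset (Fin m)}
    (ha : insert a P ∈ H) (hb : insert b P ∈ H) (haP : a ∉ P) (hbP : b ∉ P) (hab : a ≠ b)
    (hg : g ∈ H) (hag : a ∈ g) : b ∉ g := by
  intro hbg
  refine hc _ ha _ hb _ hg ?_ ?_ ?_ ?_
  · intro h
    have : a ∈ insert b P := h ▸ mem_insert_self a P
    grind
  · rintro rfl
    grind
  · rintro rfl
    grind
  · intro x hx
    rw [mem_symmDiff] at hx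
    grind

lemma Cancellative.mono {m : ℕ} {H H' : Finset (Finset (Fin m))}
    (hc : Cancellative m H) (h : H' ⊆ H) : Cancellative m H' :=
  fun A hA B hB C hC => hc A (h hA) B (h hB) C (h hC)

/-- The trace of an edge outside a fixed edge determines it. -/
lemma Cancellative.injOn_sdiff {m : ℕ} {H : Finset (Finset (Fin m))}
    (hH : ∀ e ∈ H, e.card = 3) (hc : Cancellative m H) {e₀ : Finset (Fin m)} (he₀ : e₀ ∈ H) :
    Set.InjOn (fun e => e \ e₀) (H : Set (Finset (Fin m))) := by
  intro e he f hf hef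
  have hef : e \ e₀ = f \ e₀ := hef
  by_contra hne
  have key : ∀ g ∈ H, g \ e₀ = e₀ \ e₀ → g = e₀ := by
    intro g hg h
    rw [sdiff_self, bot_eq_empty, sdiff_eq_empty_iff_subset] at h
    exact eq_of_subset_of_card_le h (by rw [hH g hg, hH e₀ he₀])
  refine hc e he f hf e₀ he₀ hne ?_ ?_ ?_
  · rintro rfl
    exact hne (key f hf hef.symm).symm
  · rintro rfl
    exact hne (key e he hef)
  · intro x hx
    rw [mem_symmDiff] at hx
    by_contra hx₀
    have : x ∈ e \ e₀ ↔ x ∈ f \ e₀ := by rw [hef]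
    simp only [mem_sdiff] at this
    tauto

/-- **Turán bound** for graphs without a 4-clique, given as a family of pairs. -/
lemma three_mul_card_le_sq_of_no_four_clique {m : ℕ} {T : Finset (Fin m)}
    {P : Finset (Finset (Fin m))} (hP : P ⊆ T.powersetCard 2)
    (hK : ∀ K ⊆ T, K.card = 4 → ¬ ∀ a ∈ K, ∀ b ∈ K, a ≠ b → {a, b} ∈ P) :
    3 * P.card ≤ T.card ^ 2 := by
  let G : SimpleGraph T :=
    { Adj := fun a b => a ≠ b ∧ ({a.1, b.1} : Finset (Fin m)) ∈ P
      symm := ⟨fun a b h => ⟨h.1.symm, by rw [pair_comm]; exact h.2⟩⟩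
      loopless := ⟨fun a h => h.1 rfl⟩ }
  have hfree : G.CliqueFree (3 + 1) := by
    intro t ht
    refine hK (t.map (Function.Embedding.subtype _)) ?_ ?_ ?_
    · intro x hx
      obtain ⟨y, -, rfl⟩ := mem_map.1 hx
      exact y.2
    · rw [card_map, ht.card_eq]
    · intro a ha b hb hab
      obtain ⟨a', ha', rfl⟩ := mem_map.1 ha
      obtain ⟨b', hb', rfl⟩ := mem_map.1 hb
      exact (ht.isClique ha' hb' (by rintro rfl; exact hab rfl)).2
  have hturan := hfree.card_edgeFinset_le
  have hle : P.card ≤ G.edgeFinset.card := by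
    refine (card_le_card (t := G.edgeFinset.image
      fun z => z.toFinset.map (Function.Embedding.subtype _)) ?_).trans card_image_le
    intro p hp
    obtain ⟨hpT, hp2⟩ := mem_powersetCard.1 (hP hp)
    obtain ⟨a, b, hab, rfl⟩ := card_eq_two.1 hp2
    refine mem_image.2 ⟨s(⟨a, hpT (by simp)⟩, ⟨b, hpT (by simp)⟩), ?_, ?_⟩
    · rw [SimpleGraph.mem_edgeFinset, SimpleGraph.mem_edgeSet]
      exact ⟨by simpa using hab, hp⟩
    · rw [Sym2.toFinset_mk_eq]
      simp [map_insert]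
  simp only [Fintype.card_coe] at hturan
  have hmod : T.card % 3 = 0 ∨ T.card % 3 = 1 ∨ T.card % 3 = 2 := by omega
  have hmul : T.card % 3 ≤ T.card := Nat.mod_le _ _
  have hsq := Nat.pow_le_pow_left hmul 2
  rcases hmod with h | h | h <;> rw [h] at hturan hsq <;> norm_num at hturan hsq <;> omega

lemma t3_three_mul (k : ℕ) : t3 (3 * k) = k * k * k := by
  rw [t3, show 3 * k / 3 = k by omega, show (3 * k + 1) / 3 = k by omega,
    show (3 * k + 2) / 3 = k by omega]

lemma t3_three_mul_add_one (k : ℕ) : t3 (3 * k + 1) = k * k * (k + 1) := by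
  rw [t3, show (3 * k + 1) / 3 = k by omega, show (3 * k + 1 + 1) / 3 = k by omega,
    show (3 * k + 1 + 2) / 3 = k + 1 by omega]

lemma t3_three_mul_add_two (k : ℕ) : t3 (3 * k + 2) = k * (k + 1) * (k + 1) := by
  rw [t3, show (3 * k + 2) / 3 = k by omega, show (3 * k + 2 + 1) / 3 = k + 1 by omega,
    show (3 * k + 2 + 2) / 3 = k + 1 by omega]

lemma t3_add_three (m : ℕ) : t3 (m + 3) = t3 m + m ^ 2 / 3 + m + 1 := by
  obtain ⟨k, rfl | rfl | rfl⟩ : ∃ k, m = 3 * k ∨ m = 3 * k + 1 ∨ m = 3 * k + 2 :=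
    ⟨m / 3, by omega⟩
  · rw [show 3 * k + 3 = 3 * (k + 1) by ring, t3_three_mul, t3_three_mul,
      show (3 * k) ^ 2 / 3 = 3 * k ^ 2 by
        rw [show (3 * k) ^ 2 = 3 * (3 * k ^ 2) by ring]; omega]
    ring
  · rw [show 3 * k + 1 + 3 = 3 * (k + 1) + 1 by ring, t3_three_mul_add_one, t3_three_mul_add_one,
      show (3 * k + 1) ^ 2 / 3 = 3 * k ^ 2 + 2 * k by
        rw [show (3 * k + 1) ^ 2 = 3 * (3 * k ^ 2 + 2 * k) + 1 by ring]; omega]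
    ring
  · rw [show 3 * k + 2 + 3 = 3 * (k + 1) + 2 by ring, t3_three_mul_add_two, t3_three_mul_add_two,
      show (3 * k + 2) ^ 2 / 3 = 3 * k ^ 2 + 4 * k + 1 by
        rw [show (3 * k + 2) ^ 2 = 3 * (3 * k ^ 2 + 4 * k + 1) + 1 by ring]; omega]
    ring

lemma t3_add_lt_of_seven_mul_le {n d : ℕ} (hn : 7 ≤ n) (hd : 7 * d ≤ n.choose 2) :
    t3 (n - 1) + d < t3 n := by
  have hd : 14 * d ≤ n * (n - 1) := by
    have := Nat.div_mul_le_self (n * (n - 1)) 2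
    rw [Nat.choose_two_right] at hd
    omega
  obtain ⟨k, rfl | rfl | rfl⟩ : ∃ k, n = 3 * k + 1 ∨ n = 3 * k + 2 ∨ n = 3 * (k + 1) :=
    ⟨(n - 1) / 3, by omega⟩
  · rw [show 3 * k + 1 - 1 = 3 * k by omega] at *
    rw [t3_three_mul_add_one, t3_three_mul]
    nlinarith
  · rw [show 3 * k + 2 - 1 = 3 * k + 1 by omega] at *
    rw [t3_three_mul_add_one, t3_three_mul_add_two]
    nlinarith
  · rw [show 3 * (k + 1) - 1 = 3 * k + 2 by omega] at *
    rw [t3_three_mul_add_two, t3_three_mul]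
    nlinarith

lemma mul_mul_le_t3 (a b c : ℕ) : a * b * c ≤ t3 (a + b + c) := by
  induction a generalizing b c with
  | zero => simp
  | succ a ih =>
    rcases b with _ | b
    · simp
    rcases c with _ | c
    · simp
    have h := ih b c
    rw [show a + 1 + (b + 1) + (c + 1) = a + b + c + 3 by ring, t3_add_three]
    have hsq : a * b + a * c + b * c ≤ (a + b + c) ^ 2 / 3 := by
      rw [Nat.le_div_iff_mul_le (by norm_num)]
      zify
      nlinarith [sq_nonneg ((a : ℤ) - b), sq_nonneg ((a : ℤ) - c), sq_nonneg ((b : ℤ) - c)]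
    nlinarith

lemma parts_eq_of_t3_le_mul {a b c n : ℕ} (hn : a + b + c = n) (hpos : 0 < t3 n)
    (h : t3 n ≤ a * b * c) :
    (a = n / 3 ∨ a = (n + 2) / 3) ∧ (b = n / 3 ∨ b = (n + 2) / 3) ∧
      (c = n / 3 ∨ c = (n + 2) / 3) := by
  subst hn
  rcases a with _ | a
  · rw [zero_mul, zero_mul] at h; omega
  rcases b with _ | b
  · rw [mul_zero, zero_mul] at h; omega
  rcases c with _ | c
  · rw [mul_zero] at h; omega
  rw [show a + 1 + (b + 1) + (c + 1) = a + b + c + 3 by ring] at *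
  rw [t3_add_three] at h
  have hle := mul_mul_le_t3 a b c
  have hsq : (a + b + c) ^ 2 / 3 ≤ a * b + a * c + b * c := by nlinarith
  have hsq' : (a + b + c) ^ 2 ≤ 3 * (a * b + a * c + b * c) + 2 := by omega
  have hlt : ((a : ℤ) - b) ^ 2 + ((a : ℤ) - c) ^ 2 + ((b : ℤ) - c) ^ 2 ≤ 4 := by
    zify at hsq'
    nlinarith
  have hab : |(a : ℤ) - b| ≤ 2 :=
    abs_le_of_sq_le_sq (by nlinarith [sq_nonneg ((a : ℤ) - c), sq_nonneg ((b : ℤ) - c)])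
      (by norm_num)
  have hbc : |(b : ℤ) - c| ≤ 2 :=
    abs_le_of_sq_le_sq (by nlinarith [sq_nonneg ((a : ℤ) - c), sq_nonneg ((a : ℤ) - b)])
      (by norm_num)
  obtain ⟨x, hx⟩ : ∃ x : ℤ, x = (a : ℤ) - b := ⟨_, rfl⟩
  obtain ⟨y, hy⟩ : ∃ y : ℤ, y = (b : ℤ) - c := ⟨_, rfl⟩
  rw [← hx] at hab
  rw [← hy] at hbc
  rw [← hx, ← hy, show (a : ℤ) - c = x + y by omega] at hlt
  rw [abs_le] at hab hbc
  obtain ⟨hx1, hx2⟩ := hab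
  obtain ⟨hy1, hy2⟩ := hbc
  interval_cases x <;> interval_cases y <;> first | (exfalso; revert hlt; norm_num; done) | omega

/-- If every pair inside `Q` lies in an edge, the links of the vertices of `Q` are disjoint. -/
lemma Cancellative.sum_degree_le {m : ℕ} {H : Finset (Finset (Fin m))} {S Q : Finset (Fin m)}
    (hH : H ⊆ S.powersetCard 3) (hc : Cancellative m H)
    (hQ : ∀ s ∈ Q, ∀ t ∈ Q, s ≠ t → ∃ g ∈ H, s ∈ g ∧ t ∈ g) :
    ∑ s ∈ Q, (H.filter (s ∈ ·)).card ≤ S.card.choose 2 := by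
  have hcard : ∀ s ∈ Q, (H.filter (s ∈ ·)).card =
      ((H.filter (s ∈ ·)).image (fun e => e.erase s)).card := by
    intro s _
    rw [card_image_of_injOn]
    intro e he f hf hef
    have he := (mem_filter.1 he).2
    have hf := (mem_filter.1 hf).2
    have hef : e.erase s = f.erase s := hef
    rw [← insert_erase he, hef, insert_erase hf]
  rw [sum_congr rfl hcard, ← card_biUnion, ← card_powersetCard]
  · refine card_le_card fun p hp => ?_
    simp only [mem_biUnion, mem_image, mem_filter] at hp
    obtain ⟨s, -, e, ⟨he, hse⟩, rfl⟩ := hp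
    obtain ⟨h1, h2⟩ := mem_powersetCard.1 (hH he)
    exact mem_powersetCard.2 ⟨(erase_subset _ _).trans h1, by rw [card_erase_of_mem hse, h2]⟩
  · intro s hs t ht hst
    refine disjoint_left.2 fun p hp hp' => ?_
    simp only [mem_image, mem_filter] at hp hp'
    obtain ⟨e, ⟨he, hse⟩, rfl⟩ := hp
    obtain ⟨f, ⟨hf, htf⟩, hef⟩ := hp'
    obtain ⟨g, hg, hsg, htg⟩ := hQ s hs t ht hst
    refine hc.not_mem_of_insert_mem (P := e.erase s) (a := s) (b := t) ?_ ?_ ?_ ?_ hst hg hsg htg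
    · rwa [insert_erase hse]
    · rwa [← hef, insert_erase htf]
    · simp
    · rw [← hef]; simp

/-- A 4-clique in the union of the links of an edge spans, with that edge, seven vertices whose
pairs are all covered by edges. -/
lemma Cancellative.covered_of_clique {m : ℕ} {H : Finset (Finset (Fin m))}
    (hc : Cancellative m H) {e₀ K : Finset (Fin m)} (he₀ : e₀ ∈ H) (he₀c : e₀.card = 3)
    (hK : K.card = 4) (hd : Disjoint e₀ K)
    (hcl : ∀ a ∈ K, ∀ b ∈ K, a ≠ b → ∃ u ∈ e₀, insert u {a, b} ∈ H) :
    ∀ s ∈ e₀ ∪ K, ∀ t ∈ e₀ ∪ K, s ≠ t → ∃ g ∈ H, s ∈ g ∧ t ∈ g := by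
  have hmix : ∀ a ∈ K, ∀ u ∈ e₀, ∃ g ∈ H, a ∈ g ∧ u ∈ g := by
    intro a ha
    choose! c hc₀ hcH using hcl a ha
    have hmaps : Set.MapsTo c (K.erase a : Finset (Fin m)) e₀ := fun b hb =>
      hc₀ b (mem_of_mem_erase hb) (ne_of_mem_erase hb).symm
    have hinj : Set.InjOn c (K.erase a : Finset (Fin m)) := by
      intro b hb b' hb' hbb
      by_contra hne
      have hb := mem_erase.1 (mem_coe.1 hb)
      have hb' := mem_erase.1 (mem_coe.1 hb')
      obtain ⟨u, -, hu⟩ := hcl b hb.2 b' hb'.2 hne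
      have hcb := hc₀ b hb.2 hb.1.symm
      have hd' := disjoint_left.1 hd hcb
      refine hc.not_mem_of_insert_mem (P := {c b, a}) (a := b) (b := b')
        ?_ ?_ ?_ ?_ hne hu (by simp) (by simp)
      · convert hcH b hb.2 hb.1.symm using 1
        ext; simp; tauto
      · convert hcH b' hb'.2 hb'.1.symm using 1
        rw [← hbb]
        ext; simp; tauto
      · grind
      · grind
    intro u hu
    obtain ⟨b, hb, rfl⟩ := surjOn_of_injOn_of_card_le c hmaps hinj
      (by rw [card_erase_of_mem ha, hK, he₀c]) hu
    have hb := mem_erase.1 (mem_coe.1 hb)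
    exact ⟨_, hcH b hb.2 hb.1.symm, by simp, by simp⟩
  intro s hs t ht hst
  rcases mem_union.1 hs with hs | hs <;> rcases mem_union.1 ht with ht | ht
  · exact ⟨e₀, he₀, hs, ht⟩
  · obtain ⟨g, hg, h1, h2⟩ := hmix t ht s hs
    exact ⟨g, hg, h2, h1⟩
  · exact hmix s hs t ht
  · obtain ⟨u, -, hu⟩ := hcl s hs t ht hst
    exact ⟨_, hu, by simp, by simp⟩

/-- **Bollobás bound**, with a consequence of equality: the edges meeting some edge `e₀` in two
vertices cover all vertices outside `e₀`. -/
lemma Cancellative.card_le_t3 {m : ℕ} (n : ℕ) (S : Finset (Fin m)) (hS : S.card = n)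
    (H : Finset (Finset (Fin m))) (hH : H ⊆ S.powersetCard 3) (hc : Cancellative m H) :
    H.card ≤ t3 n ∧ (H.card = t3 n → H.Nonempty →
      ∃ e₀ ∈ H, ∀ v ∈ S \ e₀, ∃ e ∈ H, e \ e₀ = {v}) := by
  induction n using Nat.strong_induction_on generalizing S H with
  | _ n ih =>
  rcases H.eq_empty_or_nonempty with rfl | ⟨e₀, he₀⟩
  · simp
  obtain ⟨he₀S, he₀c⟩ := mem_powersetCard.1 (hH he₀)
  have hn : (S \ e₀).card + 3 = n := by
    rw [← he₀c, card_sdiff_add_card_eq_card he₀S, hS]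
  have hH3 : ∀ e ∈ H, e.card = 3 := fun e he => (mem_powersetCard.1 (hH he)).2
  set T := S \ e₀ with hT
  let P := (T.powersetCard 2).filter fun p => ∃ u ∈ e₀, insert u p ∈ H
  by_cases hK : ∀ K ⊆ T, K.card = 4 → ¬ ∀ a ∈ K, ∀ b ∈ K, a ≠ b → {a, b} ∈ P
  · have hP := three_mul_card_le_sq_of_no_four_clique (filter_subset _ _ : P ⊆ _) hK
    let V := T.filter fun v => ∃ e ∈ H, e \ e₀ = {v}
    let H' := H.filter (· ⊆ T)
    have hVT : V.card ≤ T.card := card_filter_le _ _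
    have hH' : H'.card ≤ t3 T.card := by
      refine (ih T.card (by omega) T rfl H' (fun e he => ?_) (hc.mono (filter_subset _ _))).1
      rw [mem_filter] at he
      exact mem_powersetCard.2 ⟨he.2, hH3 e he.1⟩
    have hcard : H.card ≤ H'.card + P.card + V.card + 1 := by
      rw [← card_image_of_injOn (hc.injOn_sdiff hH3 he₀)]
      refine (card_le_card (t := ((H' ∪ P) ∪ V.image singleton) ∪ {∅}) ?_).trans ?_
      · intro p hp
        obtain ⟨e, he, rfl⟩ := mem_image.1 hp
        have heT : e \ e₀ ⊆ T := sdiff_subset_sdiff (mem_powersetCard.1 (hH he)).1 subset_rfl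
        have hsum := card_sdiff_add_card_inter e e₀
        rw [hH3 e he] at hsum
        obtain h | h | h | h : (e \ e₀).card = 0 ∨ (e \ e₀).card = 1 ∨ (e \ e₀).card = 2 ∨
            (e \ e₀).card = 3 := by omega
        · simp [card_eq_zero.1 h]
        · obtain ⟨v, hv⟩ := card_eq_one.1 h
          have hvV : v ∈ V := mem_filter.2 ⟨heT (by simp [hv]), e, he, hv⟩
          simp only [hv, mem_union, mem_image]
          exact Or.inl (Or.inr ⟨v, hvV, rfl⟩)
        · obtain ⟨u, hu⟩ := card_eq_one.1 (show (e ∩ e₀).card = 1 by omega)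
          have hpP : e \ e₀ ∈ P := by
            refine mem_filter.2 ⟨mem_powersetCard.2 ⟨heT, h⟩, u, ?_, ?_⟩
            · exact (mem_inter.1 (hu ▸ mem_singleton_self u : u ∈ e ∩ e₀)).2
            · rwa [insert_eq, ← hu, union_comm, sdiff_union_inter]
          simp only [mem_union]
          tauto
        · have hee : e \ e₀ = e := eq_of_subset_of_card_le sdiff_subset (by rw [h, hH3 e he])
          have : e \ e₀ ∈ H' := mem_filter.2 ⟨by rwa [hee], heT⟩
          simp only [mem_union]
          tauto
      · grw [card_union_le, card_union_le, card_union_le, card_image_le, card_singleton]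
    have ht3 : t3 n = t3 T.card + T.card ^ 2 / 3 + T.card + 1 := by rw [← hn, t3_add_three]
    have hP' : P.card ≤ T.card ^ 2 / 3 := by
      rw [Nat.le_div_iff_mul_le (by norm_num), mul_comm]
      exact hP
    refine ⟨by omega, fun heq _ => ⟨e₀, he₀, fun v hv => ?_⟩⟩
    have hVeq : V = T := eq_of_subset_of_card_le (filter_subset _ _) (by omega)
    exact (mem_filter.1 (hVeq.symm ▸ hv : v ∈ V)).2
  · push Not at hK
    obtain ⟨K, hKT, hK4, hcl⟩ := hK
    have hd : Disjoint e₀ K := disjoint_sdiff.mono_right hKT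
    have hcov := hc.covered_of_clique he₀ he₀c hK4 hd
      fun a ha b hb hab => (mem_filter.1 (hcl a ha b hb hab)).2
    have hQ : (e₀ ∪ K).card = 7 := by rw [card_union_of_disjoint hd, he₀c, hK4]
    have hQS : e₀ ∪ K ⊆ S := union_subset he₀S (hKT.trans sdiff_subset)
    have hsum := hc.sum_degree_le hH hcov
    obtain ⟨s, hs, hdeg⟩ : ∃ s ∈ e₀ ∪ K, 7 * (H.filter (s ∈ ·)).card ≤ n.choose 2 := by
      by_contra! hcon
      have hlt : ∑ s ∈ e₀ ∪ K, n.choose 2 < ∑ s ∈ e₀ ∪ K, 7 * (H.filter (s ∈ ·)).card :=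
        sum_lt_sum_of_nonempty (card_pos.1 (by omega)) hcon
      rw [sum_const, hQ, ← mul_sum, smul_eq_mul] at hlt
      rw [hS] at hsum
      omega
    have hn7 : 7 ≤ n := by rw [← hQ, ← hS]; exact card_le_card hQS
    have hlt := t3_add_lt_of_seven_mul_le hn7 hdeg
    have hdel := (ih (n - 1) (by omega) (S.erase s) (by rw [card_erase_of_mem (hQS hs), hS])
      (H.filter (s ∉ ·)) (fun e he => ?_) (hc.mono (filter_subset _ _))).1
    · have := card_filter_add_card_filter_not (s := H) (s ∈ ·)
      constructor
      · omega
      · intro; omega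
    · rw [mem_filter] at he
      obtain ⟨h1, h2⟩ := mem_powersetCard.1 (hH he.1)
      exact mem_powersetCard.2 ⟨subset_erase.2 ⟨h1, he.2⟩, h2⟩

lemma card_transversals_le {n : ℕ} (f : Fin n → Fin 3) :
    (univ.filter (fun A : Finset (Fin n) =>
        A.card = 3 ∧ ∀ i : Fin 3, (A.filter fun v => f v = i).card = 1)).card ≤
      (univ.filter fun v => f v = 0).card * (univ.filter fun v => f v = 1).card *
        (univ.filter fun v => f v = 2).card := by
  rw [← card_product, ← card_product]
  refine (card_le_card (t := Finset.image
    (fun p : (Fin n × Fin n) × Fin n => ({p.1.1, p.1.2, p.2} : Finset (Fin n))) _) ?_).trans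
      card_image_le
  intro A hA
  obtain ⟨-, -, hA⟩ := mem_filter.1 hA
  obtain ⟨a, ha⟩ := card_eq_one.1 (hA 0)
  obtain ⟨b, hb⟩ := card_eq_one.1 (hA 1)
  obtain ⟨c, hc⟩ := card_eq_one.1 (hA 2)
  simp only [Finset.ext_iff, mem_filter, mem_singleton] at ha hb hc
  refine mem_image.2 ⟨((a, b), c), ?_, ?_⟩
  · simp only [mem_product, mem_filter, mem_univ, true_and]
    exact ⟨⟨((ha a).2 rfl).2, ((hb b).2 rfl).2⟩, ((hc c).2 rfl).2⟩
  · ext v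
    simp only [mem_insert, mem_singleton, ← ha, ← hb, ← hc]
    have : f v = 0 ∨ f v = 1 ∨ f v = 2 := by
      generalize f v = i
      fin_cases i <;> simp
    tauto

theorem stmt_4 (n : ℕ) (H : Finset (Finset (Fin n)))
    (hH : ∀ e ∈ H, e.card = 3) (hc : Cancellative n H)
    (hcard : H.card = t3 n) (hpos : 0 < t3 n) :
    ∃ f : Fin n → Fin 3,
      (∀ i : Fin 3, (Finset.univ.filter fun v => f v = i).card = n / 3 ∨
          (Finset.univ.filter fun v => f v = i).card = (n + 2) / 3) ∧
      H = Finset.univ.filter (fun A : Finset (Fin n) =>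
        A.card = 3 ∧ ∀ i : Fin 3, (A.filter fun v => f v = i).card = 1) := by
  obtain ⟨hle, hext⟩ := hc.card_le_t3 n univ (by simp) H
    (fun e he => mem_powersetCard.2 ⟨subset_univ _, hH e he⟩)
  obtain ⟨e₀, he₀, hcov⟩ := hext hcard (card_pos.1 (by omega))
  have hw : ∀ v, ∃ w ∈ e₀, v ∉ e₀.erase w ∧ insert v (e₀.erase w) ∈ H := by
    intro v
    by_cases hv : v ∈ e₀
    · exact ⟨v, hv, by simp, by rwa [insert_erase hv]⟩
    obtain ⟨e, he, hev⟩ := hcov v (by simpa using hv)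
    have h1 := card_sdiff_add_card_inter e e₀
    have h2 := card_sdiff_add_card_inter e₀ e
    rw [hev, card_singleton, hH e he] at h1
    rw [inter_comm, hH e₀ he₀] at h2
    obtain ⟨w, hw⟩ := card_eq_one.1 (show (e₀ \ e).card = 1 by omega)
    refine ⟨w, (mem_sdiff.1 (hw ▸ mem_singleton_self w : w ∈ e₀ \ e)).1, by simp [hv], ?_⟩
    convert he
    rw [erase_eq, ← hw, sdiff_sdiff_right_self, inf_eq_inter, insert_eq, ← hev, inter_comm,
      sdiff_union_inter]
  choose w hwe hwv hwH using hw
  have hinj : ∀ e ∈ H, Set.InjOn w (e : Set (Fin n)) := by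
    intro e he v hv v' hv' hvv
    by_contra hne
    exact hc.not_mem_of_insert_mem (P := e₀.erase (w v)) (hwH v) (hvv ▸ hwH v') (hwv v)
      (hvv ▸ hwv v') hne he hv hv'
  let φ : e₀ ≃ Fin 3 := e₀.equivFinOfCardEq (hH e₀ he₀)
  let f : Fin n → Fin 3 := fun v => φ ⟨w v, hwe v⟩
  have hf : ∀ v v', f v = f v' → w v = w v' := by
    intro v v' h
    simpa using φ.injective h
  have hsub : H ⊆ univ.filter (fun A : Finset (Fin n) =>
      A.card = 3 ∧ ∀ i : Fin 3, (A.filter fun v => f v = i).card = 1) := by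
    intro e he
    have hinj' : Set.InjOn f (e : Set (Fin n)) := fun v hv v' hv' h =>
      hinj e he hv hv' (hf v v' h)
    refine mem_filter.2 ⟨mem_univ _, hH e he, fun i => ?_⟩
    obtain ⟨v, hv, rfl⟩ := surjOn_of_injOn_of_card_le (t := univ) f (fun _ _ => by simp) hinj'
      (by simp [hH e he]) (mem_coe.2 (mem_univ i))
    refine card_eq_one.2 ⟨v, ?_⟩
    ext v'
    simp only [mem_filter, mem_singleton]
    exact ⟨fun h => hinj' h.1 hv h.2, by rintro rfl; exact ⟨mem_coe.1 hv, rfl⟩⟩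
  have hsum : (univ.filter fun v => f v = 0).card + (univ.filter fun v => f v = 1).card +
      (univ.filter fun v => f v = 2).card = n := by
    have := card_eq_sum_card_fiberwise (f := f) (s := univ) (t := univ) (fun _ _ => by simp)
    rw [Fin.sum_univ_three, card_univ, Fintype.card_fin] at this
    exact this.symm
  have hT := card_transversals_le f
  have hmul := mul_mul_le_t3 (univ.filter fun v => f v = 0).card
    (univ.filter fun v => f v = 1).card (univ.filter fun v => f v = 2).card
  rw [hsum] at hmul
  have hparts := parts_eq_of_t3_le_mul hsum hpos
    (hcard ▸ (card_le_card hsub).trans hT)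
  refine ⟨f, fun i => ?_, eq_of_subset_of_card_le hsub (by omega)⟩
  obtain ⟨h0, h1, h2⟩ := hparts
  fin_cases i
  · exact h0
  · exact h1
  · exact h2
end

section
/- For every δ > 0, setting ε = δ/100, there exists n₀ such that for all n ≥ n₀ the following holds: every cancellative 3-graph H on [n] with at least (1−ε)·t_3(n,3) edges admits a partition [n] = V₁ ∪ V₂ ∪ V₃ such that the number of edges of H that do not have exactly one vertex in each V_i is at most δ·n³. -/
open Finset
open scoped Classical

/-- The inequality `(∑ d) ^ 3 ≤ n * (∑ q) * (∑ d * g)` when `d ^ 2 ≤ q * g` termwise. -/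
theorem sum_pow_three_le_card_mul {V : Type*} [Fintype V] (d q g : V → ℝ)
    (hd : ∀ a, 0 ≤ d a) (hq : ∀ a, 0 ≤ q a) (hg : ∀ a, 0 ≤ g a)
    (h : ∀ a, d a ^ 2 ≤ q a * g a) :
    (∑ a, d a) ^ 3 ≤ Fintype.card V * (∑ a, q a) * ∑ a, d a * g a := by
  have h1 : (∑ a, d a * √(d a)) ^ 2 ≤ (∑ a, q a) * ∑ a, d a * g a := by
    refine sum_sq_le_sum_mul_sum_of_sq_le_mul _ (fun a _ => hq a)
      (fun a _ => mul_nonneg (hd a) (hg a)) fun a _ => ?_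
    rw [mul_pow, Real.sq_sqrt (hd a)]
    nlinarith [mul_le_mul_of_nonneg_right (h a) (hd a)]
  have h2 : (∑ a, d a) ^ 2 ≤ (∑ a, d a * √(d a)) * ∑ a, √(d a) := by
    refine sum_sq_le_sum_mul_sum_of_sq_le_mul _
      (fun a _ => mul_nonneg (hd a) (Real.sqrt_nonneg _)) (fun a _ => Real.sqrt_nonneg _)
      fun a _ => ?_
    rw [mul_assoc, Real.mul_self_sqrt (hd a), sq]
  have h3 : (∑ a, √(d a)) ^ 2 ≤ Fintype.card V * ∑ a, d a := by
    have := sq_sum_le_card_mul_sum_sq (s := (univ : Finset V)) (f := fun a => √(d a))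
    simpa only [Real.sq_sqrt (hd _), card_univ] using this
  have hD : 0 ≤ ∑ a, d a := sum_nonneg fun a _ => hd a
  set D := ∑ a, d a
  set A := ∑ a, d a * √(d a)
  set B := ∑ a, √(d a)
  rcases hD.eq_or_lt with h0 | hpos
  · rw [← h0]
    have hQ := sum_nonneg fun a (_ : a ∈ univ) => hq a
    have hDG := sum_nonneg fun a (_ : a ∈ univ) => mul_nonneg (hd a) (hg a)
    simpa using mul_nonneg (mul_nonneg (Nat.cast_nonneg (Fintype.card V)) hQ) hDG
  have h4 : D ^ 3 * D ≤ (Fintype.card V * A ^ 2) * D := by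
    calc D ^ 3 * D = (D ^ 2) ^ 2 := by ring
      _ ≤ (A * B) ^ 2 := by gcongr
      _ = A ^ 2 * B ^ 2 := by ring
      _ ≤ A ^ 2 * (Fintype.card V * D) := by gcongr
      _ = _ := by ring
  calc D ^ 3 ≤ Fintype.card V * A ^ 2 := le_of_mul_le_mul_right h4 hpos
    _ ≤ Fintype.card V * ((∑ a, q a) * ∑ a, d a * g a) := by gcongr
    _ = _ := by ring

/-- A symmetric `{0,1}`-valued function whose links of related vertices are disjoint:
if all codegree sums over triples are at most `K`, then the sum `S` of the squared codegrees is
at most `K / 3` times the number of triples, and `S` bounds the number of triples. -/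
theorem exists_sum_codegree_bound {V : Type*} [Fintype V] (t : V → V → V → ℝ)
    (h0 : ∀ a b c, 0 ≤ t a b c) (h1 : ∀ a b c, t a b c ≤ 1)
    (hs1 : ∀ a b c, t a b c = t b a c) (hs2 : ∀ a b c, t a b c = t a c b)
    (hdis : ∀ a b c u v, t u v c ≠ 0 → t a b u * t a b v = 0) (K : ℝ)
    (hK : ∀ a b c, t a b c ≠ 0 → (∑ w, t a b w) + (∑ w, t b c w) + (∑ w, t a c w) ≤ K) :
    ∃ S : ℝ, 3 * S ≤ K * ∑ a, ∑ b, ∑ c, t a b c ∧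
      (∑ a, ∑ b, ∑ c, t a b c) ^ 3 ≤
        Fintype.card V * S * (Fintype.card V * (∑ a, ∑ b, ∑ c, t a b c) - S) := by
  set γ : V → V → ℝ := fun a b => ∑ w, t a b w with hγ
  have hγ0 : ∀ a b, 0 ≤ γ a b := fun a b => sum_nonneg fun w _ => h0 a b w
  have hγs : ∀ a b, γ a b = γ b a := fun a b => sum_congr rfl fun w _ => hs1 a b w
  set G : V → V → ℝ := fun a b => if γ a b = 0 then 0 else 1 with hG
  have hG0 : ∀ a b, 0 ≤ G a b := fun a b => by simp only [hG]; split_ifs <;> norm_num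
  have hG2 : ∀ a b, G a b ^ 2 = G a b := fun a b => by simp only [hG]; split_ifs <;> norm_num
  have hγG : ∀ a b, γ a b * G a b = γ a b := fun a b => by
    simp only [hG]; split_ifs with h <;> simp [h]
  set D : V → ℝ := fun a => ∑ b, γ a b with hD
  have hD0 : ∀ a, 0 ≤ D a := fun a => sum_nonneg fun b _ => hγ0 a b
  have hDu : ∀ u, ∑ a, ∑ b, t a b u = D u := fun u => by
    simp only [hD, hγ]
    refine sum_congr rfl fun a _ => sum_congr rfl fun b _ => ?_
    rw [hs2, hs1]
  set S : ℝ := ∑ a, ∑ b, γ a b ^ 2 with hS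
  have hM : ∑ a, ∑ b, ∑ c, t a b c = ∑ a, D a := rfl
  have hSQ : S ≤ Fintype.card V * (∑ a, D a) - ∑ a, D a * ∑ b, G a b := by
    have e1 : S = ∑ u, ∑ v, ∑ a, ∑ b, t a b u * t a b v := by
      simp only [hS, hγ, sq, sum_mul_sum]
      rw [sum_congr rfl fun a _ => sum_comm, sum_comm]
      refine sum_congr rfl fun u _ => ?_
      exact (sum_congr rfl fun a _ => sum_comm).trans sum_comm
    have e2 : ∀ u v, ∑ a, ∑ b, t a b u * t a b v ≤ D u * (1 - G u v) := by
      intro u v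
      by_cases h : γ u v = 0
      · simp only [hG, h, if_true, sub_zero, mul_one]
        rw [← hDu u]
        exact sum_le_sum fun a _ => sum_le_sum fun b _ =>
          mul_le_of_le_one_right (h0 _ _ _) (h1 _ _ _)
      · obtain ⟨c, -, hc⟩ := exists_ne_zero_of_sum_ne_zero h
        simp [hG, h, hdis _ _ c u v hc]
    rw [e1]
    calc _ ≤ ∑ u, ∑ v, D u * (1 - G u v) :=
          sum_le_sum fun u _ => sum_le_sum fun v _ => e2 u v
      _ = _ := by
        simp only [← mul_sum, sum_sub_distrib, mul_sub, sum_const, card_univ, nsmul_eq_mul,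
          mul_one]
  have hH : (∑ a, D a) ^ 3 ≤ Fintype.card V * S * ∑ a, D a * ∑ b, G a b := by
    refine sum_pow_three_le_card_mul D (fun a => ∑ b, γ a b ^ 2) (fun a => ∑ b, G a b) hD0
      (fun a => sum_nonneg fun b _ => sq_nonneg _) (fun a => sum_nonneg fun b _ => hG0 a b)
      fun a => ?_
    refine sum_sq_le_sum_mul_sum_of_sq_le_mul _ (fun b _ => sq_nonneg _)
      (fun b _ => hG0 a b) fun b _ => ?_
    rw [← hG2, ← mul_pow, hγG]
  have hS0 : 0 ≤ S := sum_nonneg fun a _ => sum_nonneg fun b _ => sq_nonneg _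
  refine ⟨S, ?_, ?_⟩
  · have f1 : S = ∑ a, ∑ b, ∑ c, t a b c * γ a b := by
      simp only [hS, ← sum_mul, sq, hγ]
    have f2 : S = ∑ a, ∑ b, ∑ c, t a b c * γ b c := by
      rw [f1, sum_congr rfl fun a _ => sum_comm, sum_comm]
      refine sum_congr rfl fun a _ => ?_
      rw [sum_comm]
      exact sum_congr rfl fun x _ => sum_congr rfl fun y _ => by rw [hs2, hs1, hs2, hγs]
    have f3 : S = ∑ a, ∑ b, ∑ c, t a b c * γ a c := by
      rw [f1]
      refine sum_congr rfl fun a _ => ?_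
      rw [sum_comm]
      exact sum_congr rfl fun b _ => sum_congr rfl fun c _ => by rw [hs2]
    have : 3 * S = ∑ a, ∑ b, ∑ c, t a b c * (γ a b + γ b c + γ a c) := by
      simp only [mul_add, sum_add_distrib]
      linarith
    rw [this, hM]
    simp only [mul_sum, hD, hγ]
    refine sum_le_sum fun a _ => sum_le_sum fun b _ => sum_le_sum fun c _ => ?_
    by_cases h : t a b c = 0
    · simp [h]
    · rw [mul_comm K]
      exact mul_le_mul_of_nonneg_left (hK a b c h) (h0 a b c)
  · rw [hM]
    exact hH.trans (mul_le_mul_of_nonneg_left (by linarith) (by positivity))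

theorem ne_of_card_insert_insert_singleton {α : Type*} [DecidableEq α] {a b c : α}
    (h : ({a, b, c} : Finset α).card = 3) : a ≠ b ∧ a ≠ c ∧ b ≠ c := by
  have h2 : ∀ x y : α, ({x, y} : Finset α).card ≠ 3 := fun x y hxy => by
    have := card_le_two (a := x) (b := y)
    omega
  refine ⟨?_, ?_, ?_⟩ <;> rintro rfl
  · exact h2 a c (by simpa using h)
  · exact h2 b a (by simpa using h)
  · exact h2 a b (by simpa using h)

theorem insert_insert_singleton_rotate {α : Type*} [DecidableEq α] (a b c : α) :
    ({a, b, c} : Finset α) = {b, c, a} := by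
  ext; simp; tauto

/-- In a cancellative 3-graph, two vertices completing the same pair to an edge are not
contained in a common edge. -/
theorem Cancellative.eq_of_mem {n : ℕ} {H : Finset (Finset (Fin n))}
    (hH : Cancellative n H) (h3 : ∀ e ∈ H, e.card = 3) {a b u v : Fin n} {e : Finset (Fin n)}
    (hu : {a, b, u} ∈ H) (hv : {a, b, v} ∈ H) (he : e ∈ H) (hue : u ∈ e) (hve : v ∈ e) :
    u = v := by
  by_contra huv
  obtain ⟨-, hau, hbu⟩ := ne_of_card_insert_insert_singleton (h3 _ hu)
  obtain ⟨-, hav, hbv⟩ := ne_of_card_insert_insert_singleton (h3 _ hv)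
  refine hH _ hu _ hv _ he ?_ ?_ ?_ ?_
  · intro h
    have : u ∈ ({a, b, v} : Finset (Fin n)) := h ▸ by simp
    simp at this; grind
  · rintro rfl
    simp at hve; grind
  · rintro rfl
    simp at hue; grind
  · intro x hx
    simp [mem_symmDiff] at hx; grind

/-- The vertices completing the pair `a, b` to an edge of `H`. -/
def pairNbhd {n : ℕ} (H : Finset (Finset (Fin n))) (a b : Fin n) : Finset (Fin n) :=
  univ.filter fun x => {a, b, x} ∈ H

theorem mem_pairNbhd {n : ℕ} {H : Finset (Finset (Fin n))} {a b x : Fin n} :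
    x ∈ pairNbhd H a b ↔ {a, b, x} ∈ H := by
  simp [pairNbhd]

theorem card_filter_inter_nonempty_le {n : ℕ} {H : Finset (Finset (Fin n))}
    (h3 : ∀ e ∈ H, e.card = 3) (R : Finset (Fin n)) :
    (H.filter fun e => ∃ x ∈ e, x ∈ R).card ≤ R.card * n ^ 2 := by
  calc _ ≤ ((R ×ˢ (univ ×ˢ univ)).image fun p : Fin n × Fin n × Fin n =>
        ({p.1, p.2.1, p.2.2} : Finset (Fin n))).card := by
        refine card_le_card fun e he => ?_
        obtain ⟨heH, x, hxe, hxR⟩ := mem_filter.1 he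
        obtain ⟨y, z, -, hyz⟩ := card_eq_two.1
          (by rw [card_erase_of_mem hxe, h3 e heH] : (e.erase x).card = 2)
        refine mem_image.2 ⟨(x, y, z), by simp [hxR], ?_⟩
        simp only [← hyz, insert_erase hxe]
    _ ≤ _ := card_image_le
    _ = _ := by simp [sq]

/-- Colouring the vertices by the neighbourhoods of the three pairs of an edge, every edge that
is not rainbow meets the complement of these neighbourhoods. -/
theorem Cancellative.exists_coloring {n : ℕ} {H : Finset (Finset (Fin n))}
    (hH : Cancellative n H) (h3 : ∀ e ∈ H, e.card = 3) {u v w : Fin n} (he : {u, v, w} ∈ H) :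
    ∃ f : Fin n → Fin 3,
      (H.filter fun e => ¬ ∀ i : Fin 3, (e.filter fun v => f v = i).card = 1).card +
        ((pairNbhd H u v).card + (pairNbhd H v w).card + (pairNbhd H u w).card) * n ^ 2
        ≤ n * n ^ 2 := by
  obtain ⟨huv, huw, hvw⟩ := ne_of_card_insert_insert_singleton (h3 _ he)
  have hd1 : Disjoint (pairNbhd H u v) (pairNbhd H v w) := by
    rw [disjoint_left]
    intro x h1 h2
    rw [mem_pairNbhd, insert_insert_singleton_rotate] at h1
    rw [mem_pairNbhd, pair_comm] at h2
    exact huw (hH.eq_of_mem h3 h1 h2 he (by simp) (by simp))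
  have hd2 : Disjoint (pairNbhd H u v ∪ pairNbhd H v w) (pairNbhd H u w) := by
    rw [disjoint_left]
    intro x h1 h2
    rw [mem_union, mem_pairNbhd, mem_pairNbhd] at h1
    rw [mem_pairNbhd] at h2
    rcases h1 with h1 | h1
    · rw [pair_comm] at h1 h2
      exact hvw (hH.eq_of_mem h3 h1 h2 he (by simp) (by simp))
    · rw [insert_insert_singleton_rotate, insert_comm] at h1
      rw [pair_comm, insert_insert_singleton_rotate] at h2
      exact huv (hH.eq_of_mem h3 h2 h1 he (by simp) (by simp))
  set N := pairNbhd H u v ∪ pairNbhd H v w ∪ pairNbhd H u w with hN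
  have hNcard : N.card =
      (pairNbhd H u v).card + (pairNbhd H v w).card + (pairNbhd H u w).card := by
    rw [hN, card_union_of_disjoint hd2, card_union_of_disjoint hd1]
  set f : Fin n → Fin 3 := fun x =>
    if x ∈ pairNbhd H u v then 0 else if x ∈ pairNbhd H v w then 1 else 2 with hf
  refine ⟨f, ?_⟩
  rw [← hNcard]
  have hsub : (H.filter fun e => ¬ ∀ i : Fin 3, (e.filter fun v => f v = i).card = 1) ⊆
      H.filter fun e => ∃ x ∈ e, x ∈ Nᶜ := by
    intro e heb
    obtain ⟨heH, hbad⟩ := mem_filter.1 heb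
    refine mem_filter.2 ⟨heH, ?_⟩
    by_contra! hcon
    have hin : ∀ x ∈ e, x ∈ N := fun x hx => by simpa using hcon x hx
    have hone : ∀ i : Fin 3, (e.filter fun v => f v = i).card ≤ 1 := by
      intro i
      rw [card_le_one]
      intro x hx y hy
      obtain ⟨hxe, hxi⟩ := mem_filter.1 hx
      obtain ⟨hye, hyi⟩ := mem_filter.1 hy
      have hxN := hin x hxe
      have hyN := hin y hye
      have hcl : ∀ a b, x ∈ pairNbhd H a b → y ∈ pairNbhd H a b → x = y := fun a b h1 h2 =>
        hH.eq_of_mem h3 (mem_pairNbhd.1 h1) (mem_pairNbhd.1 h2) heH hxe hye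
      have hxy : f x = f y := hxi.trans hyi.symm
      simp only [hN, mem_union] at hxN hyN
      simp only [hf] at hxy
      split_ifs at hxy with g1 g2 g3 g4 g5 g6 <;> grind
    have hsum : e.card = ∑ i : Fin 3, (e.filter fun v => f v = i).card :=
      card_eq_sum_card_fiberwise fun x _ => mem_univ _
    rw [h3 e heH, Fin.sum_univ_three] at hsum
    have i0 := hone 0
    have i1 := hone 1
    have i2 := hone 2
    exact hbad fun i => by fin_cases i <;> simp at * <;> omega
  have hR : Nᶜ.card + N.card = n := by
    rw [card_compl_add_card, Fintype.card_fin]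
  calc _ ≤ Nᶜ.card * n ^ 2 + N.card * n ^ 2 :=
        Nat.add_le_add_right ((card_le_card hsub).trans (card_filter_inter_nonempty_le h3 _)) _
    _ = _ := by rw [← add_mul, hR]

theorem six_mul_card_le_sum {n : ℕ} {H : Finset (Finset (Fin n))} (h3 : ∀ e ∈ H, e.card = 3) :
    6 * (H.card : ℝ) ≤
      ∑ a : Fin n, ∑ b : Fin n, ∑ c : Fin n, if {a, b, c} ∈ H then (1 : ℝ) else 0 := by
  have key : H.card * 6 ≤ ((univ : Finset (Fin n × Fin n × Fin n)).filter
      fun p => ({p.1, p.2.1, p.2.2} : Finset (Fin n)) ∈ H).card := by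
    have hfib : ∀ p ∈ (univ : Finset (Fin n × Fin n × Fin n)).filter
        (fun p => ({p.1, p.2.1, p.2.2} : Finset (Fin n)) ∈ H),
        ({p.1, p.2.1, p.2.2} : Finset (Fin n)) ∈ H := fun p hp => (mem_filter.1 hp).2
    rw [card_eq_sum_card_fiberwise hfib, ← smul_eq_mul]
    refine card_nsmul_le_sum _ _ _ fun e he => ?_
    obtain ⟨x, y, z, hxy, hxz, hyz, rfl⟩ := card_eq_three.1 (h3 e he)
    have h6 : ({(x, y, z), (x, z, y), (y, x, z), (y, z, x), (z, x, y), (z, y, x)} :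
        Finset (Fin n × Fin n × Fin n)).card = 6 := by
      simp [card_insert_of_notMem, hxy, hxz, hyz, hxy.symm, hxz.symm, hyz.symm]
    rw [← h6]
    refine card_le_card fun p hp => ?_
    have hpe : ({p.1, p.2.1, p.2.2} : Finset (Fin n)) = {x, y, z} := by
      simp only [mem_insert, mem_singleton] at hp
      rcases hp with rfl | rfl | rfl | rfl | rfl | rfl <;> ext <;> simp <;> grind
    exact mem_filter.2 ⟨mem_filter.2 ⟨mem_univ _, by rwa [hpe]⟩, hpe⟩
  calc 6 * (H.card : ℝ) = ((H.card * 6 : ℕ) : ℝ) := by push_cast; ring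
    _ ≤ _ := Nat.cast_le.2 key
    _ = _ := by
      rw [card_filter, Fintype.sum_prod_type]
      simp only [Fintype.sum_prod_type]
      push_cast
      rfl

theorem t3_lower_bound (n : ℕ) : (n : ℝ) ^ 3 - 3 * n - 2 ≤ 27 * (t3 n : ℝ) := by
  obtain ⟨k, hk⟩ : ∃ k, k = n / 3 := ⟨_, rfl⟩
  have h : n = 3 * k ∨ n = 3 * k + 1 ∨ n = 3 * k + 2 := by omega
  rcases h with h | h | h
  · have h1 : t3 n = k * k * k := by
      rw [t3, ← hk, show (n + 1) / 3 = k by omega, show (n + 2) / 3 = k by omega]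
    rw [h1, h]; push_cast; nlinarith [(Nat.cast_nonneg k : (0 : ℝ) ≤ k)]
  · have h1 : t3 n = k * k * (k + 1) := by
      rw [t3, ← hk, show (n + 1) / 3 = k by omega, show (n + 2) / 3 = k + 1 by omega]
    rw [h1, h]; push_cast; nlinarith [(Nat.cast_nonneg k : (0 : ℝ) ≤ k)]
  · have h1 : t3 n = k * (k + 1) * (k + 1) := by
      rw [t3, ← hk, show (n + 1) / 3 = k + 1 by omega, show (n + 2) / 3 = k + 1 by omega]
    rw [h1, h]; push_cast; nlinarith [(Nat.cast_nonneg k : (0 : ℝ) ≤ k)]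

theorem stmt_5 (δ : ℝ) (hδ : 0 < δ) :
    ∃ n₀ : ℕ, ∀ n : ℕ, n₀ ≤ n → ∀ H : Finset (Finset (Fin n)),
      (∀ e ∈ H, e.card = 3) → Cancellative n H →
      (1 - δ / 100) * (t3 n : ℝ) ≤ (H.card : ℝ) →
      ∃ f : Fin n → Fin 3,
        ((H.filter fun e => ¬ ∀ i : Fin 3, (e.filter fun v => f v = i).card = 1).card : ℝ)
          ≤ δ * (n : ℝ) ^ 3 := by
  refine ⟨⌈500 / δ⌉₊ + 1, fun n hn H h3 hH hcard => ?_⟩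
  have hn1 : (1 : ℝ) ≤ n := by exact_mod_cast (by omega : 1 ≤ n)
  have hnδ : 500 ≤ n * δ := by
    rw [← div_le_iff₀ hδ]
    exact (Nat.le_ceil _).trans (by exact_mod_cast (by omega : ⌈500 / δ⌉₊ ≤ n))
  by_cases hδ1 : 1 ≤ δ
  · refine ⟨fun _ => 0, ?_⟩
    have hle : (H.filter fun e => ¬ ∀ i : Fin 3,
        (e.filter fun _ => (0 : Fin 3) = i).card = 1).card ≤ n * n ^ 2 := by
      refine le_trans (card_le_card fun e he => ?_)
        ((card_filter_inter_nonempty_le h3 univ).trans_eq (by simp))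
      have heH := (mem_filter.1 he).1
      obtain ⟨x, hx⟩ := card_pos.1 (by rw [h3 e heH]; norm_num)
      exact mem_filter.2 ⟨heH, x, hx, mem_univ _⟩
    calc _ ≤ ((n * n ^ 2 : ℕ) : ℝ) := Nat.cast_le.2 hle
      _ = 1 * (n : ℝ) ^ 3 := by push_cast; ring
      _ ≤ _ := by gcongr
  push Not at hδ1
  set t : Fin n → Fin n → Fin n → ℝ := fun a b c => if {a, b, c} ∈ H then 1 else 0 with ht
  have ht0 : ∀ a b c, t a b c ≠ 0 ↔ {a, b, c} ∈ H := fun a b c => by simp [ht]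
  have hcod : ∀ a b, ∑ w, t a b w = ((pairNbhd H a b).card : ℝ) := fun a b => by
    simp [ht, pairNbhd]
  have hbig : (2 / 9) * (1 - δ / 50) * (n : ℝ) ^ 3 ≤ ∑ a, ∑ b, ∑ c, t a b c := by
    refine le_trans ?_ (six_mul_card_le_sum h3)
    have := t3_lower_bound n
    have h1 : (1 - δ / 100) * ((n : ℝ) ^ 3 - 3 * n - 2) ≤ (1 - δ / 100) * (27 * (t3 n : ℝ)) :=
      mul_le_mul_of_nonneg_left this (by linarith)
    have h2 : 3 * (n : ℝ) + 2 ≤ δ / 100 * n ^ 3 := by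
      nlinarith [mul_le_mul_of_nonneg_right hnδ (by positivity : (0 : ℝ) ≤ n ^ 2)]
    have h3 : (1 - δ / 100) * (3 * (n : ℝ) + 2) ≤ 1 * (3 * (n : ℝ) + 2) :=
      mul_le_mul_of_nonneg_right (by linarith) (by positivity)
    linarith
  obtain ⟨u, v, w, he, hlarge⟩ : ∃ u v w, {u, v, w} ∈ H ∧ (1 - δ) * n ≤
      (pairNbhd H u v).card + (pairNbhd H v w).card + (pairNbhd H u w).card := by
    by_contra! hcon
    obtain ⟨S, hS3, hS⟩ := exists_sum_codegree_bound t
      (fun a b c => by simp only [ht]; split_ifs <;> norm_num)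
      (fun a b c => by simp only [ht]; split_ifs <;> norm_num)
      (fun a b c => by simp only [ht, insert_comm])
      (fun a b c => by simp only [ht, pair_comm])
      (fun a b c u v h => by
        by_contra hne
        obtain ⟨hu, hv⟩ := mul_ne_zero_iff.1 hne
        rw [ht0] at h hu hv
        exact (ne_of_card_insert_insert_singleton (h3 _ h)).1
          (hH.eq_of_mem h3 hu hv h (by simp) (by simp)))
      ((1 - δ) * n)
      (fun a b c h => by
        rw [hcod, hcod, hcod]
        exact (hcon a b c ((ht0 a b c).1 h)).le)
    rw [Fintype.card_fin] at hS
    set M := ∑ a, ∑ b, ∑ c, t a b c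
    have hM : 0 < M := lt_of_lt_of_le
      (mul_pos (by linarith : 0 < 2 / 9 * (1 - δ / 50)) (by positivity)) hbig
    obtain ⟨p, hp⟩ : ∃ p, S = p * (n * M) := ⟨S / (n * M), by field_simp⟩
    subst hp
    have hnM : 0 < n * M := by positivity
    have hp3 : 3 * p ≤ 1 - δ := le_of_mul_le_mul_right (by linarith) hnM
    have hMp : M ≤ p * (1 - p) * n ^ 3 := by
      refine le_of_mul_le_mul_right ?_ (by positivity : 0 < M ^ 2)
      linarith
    have hpp : 2 / 9 * (1 - δ / 50) ≤ p * (1 - p) :=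
      le_of_mul_le_mul_right (hbig.trans hMp) (by positivity)
    nlinarith
  obtain ⟨f, hf⟩ := hH.exists_coloring h3 he
  refine ⟨f, ?_⟩
  have hf' : (_ : ℝ) ≤ _ := Nat.cast_le.2 hf
  push_cast at hf'
  have := mul_le_mul_of_nonneg_right hlarge (by positivity : (0 : ℝ) ≤ n ^ 2)
  linarith
end

section
/- Let ℓ ≥ 2, t ≥ 0, and let G be an n-vertex K_{ℓ+1}-free simple graph with exactly t₂(n,ℓ) − t edges. Then there exists a partition of the vertex set of G into ℓ parts such that the number of edges of G with endpoints in two different parts is at least t₂(n,ℓ) − 2t. -/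
open Finset
open scoped Classical

/-- The symmetrization step behind Füredi's stability argument, counted with ordered pairs: the
vertices of a set `S` containing no `ℓ + 1` pairwise adjacent vertices can be coloured with `ℓ`
colours so that adjacent pairs plus monochromatic adjacent pairs do not outnumber the pairs with
distinct colours. -/
lemma SimpleGraph.exists_coloring_card_adj_add_card_mono_le {V : Type*} (G : SimpleGraph V) (ℓ : ℕ)
    (S : Finset V) (hS : ∀ K ⊆ S, ¬ G.IsNClique (ℓ + 1) K) :
    ∃ f : V → ℕ, (∀ v ∈ S, f v < ℓ) ∧
      ∑ x ∈ S, ∑ y ∈ S, (if G.Adj x y then 1 else 0) +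
        ∑ x ∈ S, ∑ y ∈ S, (if G.Adj x y ∧ f x = f y then 1 else 0) ≤
      ∑ x ∈ S, ∑ y ∈ S, (if f x ≠ f y then 1 else 0) := by
  induction ℓ generalizing S with
  | zero =>
    have hS' : S = ∅ := by
      by_contra h
      obtain ⟨x, hx⟩ := Finset.nonempty_iff_ne_empty.mpr h
      exact hS {x} (by simpa using hx) (by simp [SimpleGraph.isNClique_iff])
    subst hS'
    exact ⟨fun _ => 0, by simp, by simp⟩
  | succ ℓ ih =>
    rcases S.eq_empty_or_nonempty with rfl | hne
    · exact ⟨fun _ => 0, by simp, by simp⟩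
    obtain ⟨x, hx, hmax⟩ :=
      S.exists_max_image (fun v => ∑ y ∈ S, (if G.Adj v y then 1 else 0)) hne
    set N := S.filter (G.Adj x) with hN
    set A := S.filter (fun v => ¬ G.Adj x v) with hA
    obtain ⟨f, hf, hle⟩ := ih N (by
      intro K hK hc
      refine hS (insert x K) (Finset.insert_subset hx (hK.trans (Finset.filter_subset _ _))) ?_
      exact hc.insert fun b hb => (Finset.mem_filter.mp (hK hb)).2)
    let g : V → ℕ := fun v => if G.Adj x v then f v else ℓ
    have hgN : ∀ v ∈ N, g v = f v := fun v hv => if_pos (Finset.mem_filter.mp hv).2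
    have hgA : ∀ v ∈ A, g v = ℓ := fun v hv => if_neg (Finset.mem_filter.mp hv).2
    have hdisj : ∀ v ∈ N, ∀ w ∈ A, g v ≠ g w := fun v hv w hw => by
      rw [hgN v hv, hgA w hw]; exact (hf v hv).ne
    refine ⟨g, fun v hv => ?_, ?_⟩
    · by_cases h : G.Adj x v
      · have := hf v (Finset.mem_filter.mpr ⟨hv, h⟩)
        simp only [g, if_pos h]; omega
      · simp [g, h]
    have split : ∀ F : V → V → ℕ, ∑ u ∈ S, ∑ w ∈ S, F u w =
        (∑ u ∈ N, ∑ w ∈ N, F u w + ∑ u ∈ N, ∑ w ∈ A, F u w) +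
        (∑ u ∈ A, ∑ w ∈ N, F u w + ∑ u ∈ A, ∑ w ∈ A, F u w) := fun F => by
      rw [← Finset.sum_filter_add_sum_filter_not S (G.Adj x), ← Finset.sum_add_distrib,
        ← Finset.sum_add_distrib]
      congr 1 <;> refine Finset.sum_congr rfl fun u _ => ?_ <;>
        rw [← Finset.sum_filter_add_sum_filter_not S (G.Adj x)]
    have hdeg : ∑ u ∈ A, ∑ w ∈ N, (if G.Adj u w then 1 else 0) +
        ∑ u ∈ A, ∑ w ∈ A, (if G.Adj u w then 1 else 0) ≤ #A * #N := by
      rw [← Finset.sum_add_distrib, ← smul_eq_mul]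
      refine Finset.sum_le_card_nsmul _ _ _ fun u hu => ?_
      rw [Finset.sum_filter_add_sum_filter_not S (G.Adj x)]
      refine (hmax u (Finset.mem_filter.mp hu).1).trans_eq ?_
      rw [hN, Finset.card_filter]
    have hsymm : ∑ u ∈ N, ∑ w ∈ A, (if G.Adj u w then 1 else 0) =
        ∑ u ∈ A, ∑ w ∈ N, (if G.Adj u w then 1 else 0) := by
      rw [Finset.sum_comm]
      simp only [G.adj_comm]
    have hmNN : ∑ u ∈ N, ∑ w ∈ N, (if G.Adj u w ∧ g u = g w then 1 else 0) =
        ∑ u ∈ N, ∑ w ∈ N, (if G.Adj u w ∧ f u = f w then 1 else 0) :=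
      Finset.sum_congr rfl fun u hu => Finset.sum_congr rfl fun w hw => by
        rw [hgN u hu, hgN w hw]
    have hmNA : ∑ u ∈ N, ∑ w ∈ A, (if G.Adj u w ∧ g u = g w then 1 else 0) = 0 :=
      Finset.sum_eq_zero fun u hu => Finset.sum_eq_zero fun w hw =>
        if_neg fun h => hdisj u hu w hw h.2
    have hmAN : ∑ u ∈ A, ∑ w ∈ N, (if G.Adj u w ∧ g u = g w then 1 else 0) = 0 :=
      Finset.sum_eq_zero fun u hu => Finset.sum_eq_zero fun w hw =>
        if_neg fun h => hdisj w hw u hu h.2.symm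
    have hmAA : ∑ u ∈ A, ∑ w ∈ A, (if G.Adj u w ∧ g u = g w then 1 else 0) =
        ∑ u ∈ A, ∑ w ∈ A, (if G.Adj u w then 1 else 0) :=
      Finset.sum_congr rfl fun u hu => Finset.sum_congr rfl fun w hw => by
        simp [hgA u hu, hgA w hw]
    have hcNN : ∑ u ∈ N, ∑ w ∈ N, (if g u ≠ g w then 1 else 0) =
        ∑ u ∈ N, ∑ w ∈ N, (if f u ≠ f w then 1 else 0) :=
      Finset.sum_congr rfl fun u hu => Finset.sum_congr rfl fun w hw => by
        rw [hgN u hu, hgN w hw]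
    have hcNA : ∑ u ∈ N, ∑ w ∈ A, (if g u ≠ g w then 1 else 0) = #A * #N := by
      rw [Finset.sum_congr rfl fun u hu => Finset.sum_congr rfl fun w hw =>
        if_pos (hdisj u hu w hw)]
      simp [mul_comm]
    have hcAN : ∑ u ∈ A, ∑ w ∈ N, (if g u ≠ g w then 1 else 0) = #A * #N := by
      rw [Finset.sum_congr rfl fun u hu => Finset.sum_congr rfl fun w hw =>
        if_pos (hdisj w hw u hu).symm]
      simp
    rw [split, split, split, hsymm, hmNN, hmNA, hmAN, hmAA, hcNN, hcNA, hcAN]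
    omega

lemma SimpleGraph.sum_sum_adj_eq_two_mul_card_edgeFinset {V : Type*} [Fintype V]
    (G : SimpleGraph V) [DecidableRel G.Adj] :
    ∑ x, ∑ y, (if G.Adj x y then 1 else 0) = 2 * #G.edgeFinset := by
  rw [← G.sum_degrees_eq_twice_card_edges]
  refine Finset.sum_congr rfl fun x _ => ?_
  rw [← Finset.card_filter, ← SimpleGraph.card_neighborFinset_eq_degree,
    SimpleGraph.neighborFinset_eq_filter]

lemma card_edgeFinset_turanGraph_le_turanCount (n ℓ : ℕ) :
    #(SimpleGraph.turanGraph n ℓ).edgeFinset ≤ turanCount n ℓ 2 := by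
  refine Finset.card_le_card_of_injOn Sym2.toFinset (fun e he => ?_) fun e _ e' _ h => ?_
  · induction e using Sym2.ind with
    | _ x y =>
      have hxy : x.val % ℓ ≠ y.val % ℓ := by
        simpa using SimpleGraph.turanGraph_adj.mp (SimpleGraph.mem_edgeFinset.mp he)
      have hne : x ≠ y := fun h => hxy (by rw [h])
      simp [Sym2.toFinset_mk_eq, Finset.card_pair hne, hxy, hxy.symm]
  · exact Sym2.ext fun x => by rw [← Sym2.mem_toFinset, h, Sym2.mem_toFinset]

theorem stmt_6 (n ℓ t : ℕ) (hℓ : 2 ≤ ℓ) (G : SimpleGraph (Fin n))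
    (hfree : G.CliqueFree (ℓ + 1))
    (hcard : (G.edgeFinset.card : ℤ) = (turanCount n ℓ 2 : ℤ) - (t : ℤ)) :
    ∃ f : Fin n → Fin ℓ,
      (turanCount n ℓ 2 : ℤ) - 2 * (t : ℤ) ≤
        ((G.edgeFinset.filter fun e => ∃ x ∈ e, ∃ y ∈ e, f x ≠ f y).card : ℤ) := by
  obtain ⟨f, hf, hle⟩ := G.exists_coloring_card_adj_add_card_mono_le ℓ univ
    fun K _ => hfree K
  let F : Fin n → Fin ℓ := fun v => ⟨f v, hf v (mem_univ v)⟩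
  refine ⟨F, ?_⟩
  let H : SimpleGraph (Fin n) := (⊤ : SimpleGraph ℕ).comap f
  have hH : #H.edgeFinset ≤ turanCount n ℓ 2 := by
    have hcol : H.Colorable ℓ :=
      ⟨SimpleGraph.Coloring.mk F fun {v w} hvw h =>
        hvw (Fin.mk.inj h)⟩
    refine le_trans ?_ (card_edgeFinset_turanGraph_le_turanCount n ℓ)
    convert (SimpleGraph.isTuranMaximal_turanGraph (n := n) (r := ℓ) (by omega)).2
      (hcol.cliqueFree (Nat.lt_succ_self ℓ))
  have hcut : (G.edgeFinset.filter fun e => ∃ x ∈ e, ∃ y ∈ e, F x ≠ F y) = (G ⊓ H).edgeFinset := by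
    ext e
    induction e using Sym2.ind with
    | _ x y => simp [H, F, eq_comm]
  have hsplit : ∑ x, ∑ y, (if G.Adj x y then 1 else 0) =
      ∑ x, ∑ y, (if G.Adj x y ∧ f x = f y then 1 else 0) +
        ∑ x, ∑ y, (if (G ⊓ H).Adj x y then 1 else 0) := by
    simp only [← Finset.sum_add_distrib]
    refine Finset.sum_congr rfl fun x _ => Finset.sum_congr rfl fun y _ => ?_
    by_cases h : G.Adj x y <;> by_cases h' : f x = f y <;> simp [H, h, h']
  have hHsum : ∑ x, ∑ y, (if f x ≠ f y then 1 else 0) = 2 * #H.edgeFinset := by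
    convert H.sum_sum_adj_eq_two_mul_card_edgeFinset
  have hcutsum : ∑ x, ∑ y, (if (G ⊓ H).Adj x y then 1 else 0) = 2 * #(G ⊓ H).edgeFinset := by
    convert (G ⊓ H).sum_sum_adj_eq_two_mul_card_edgeFinset
  rw [← hcut] at hcutsum
  rw [SimpleGraph.sum_sum_adj_eq_two_mul_card_edgeFinset, hcutsum] at hsplit
  rw [SimpleGraph.sum_sum_adj_eq_two_mul_card_edgeFinset, hHsum] at hle
  omega
end

section
/- Let H be a cancellative 3-graph on vertex set [n] and let T be a 2-element set contained in some edge of H. Then the neighborhood N(T) = { v ∈ [n] : T ∪ {v} ∈ H } is an independent set of H; that is, no edge of H contains two vertices of N(T). -/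
open Finset
open scoped Classical

theorem stmt_9 (n : ℕ) (H : Finset (Finset (Fin n)))
    (hH : ∀ e ∈ H, e.card = 3) (hc : Cancellative n H)
    (T : Finset (Fin n)) (hT : T.card = 2) (hTshadow : ∃ e ∈ H, T ⊆ e) :
    ∀ e ∈ H, ∀ u w : Fin n, u ≠ w →
      insert u T ∈ H → insert w T ∈ H → ¬ (u ∈ e ∧ w ∈ e) := by
  rintro e he u w huw hu hw ⟨hue, hwe⟩
  have notMem : ∀ v, insert v T ∈ H → v ∉ T := fun v hv hvT => by
    have := hH _ hv
    rw [Finset.insert_eq_of_mem hvT] at this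
    omega
  have hwu : w ∉ insert u T := by simp [huw.symm, notMem w hw]
  have huw' : u ∉ insert w T := by simp [huw, notMem u hu]
  refine hc _ hu _ hw e he ?_ ?_ ?_ ?_
  · exact fun h => hwu (h ▸ Finset.mem_insert_self w T)
  · exact fun h => hwu (h ▸ hwe)
  · exact fun h => huw' (h ▸ hue)
  · intro x hx
    simp only [Finset.mem_symmDiff, Finset.mem_insert] at hx
    grind
end
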